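/- arXiv:1307.0518 — 4 statements merged into one kernel-verified Lean document; each statement's English description precedes it below -/
import Mathlib

section
/- The first group cohomology of G with trivial coefficients ℤ satisfies H¹(G, ℤ) ≅ ℤ^{3 − r}, where r is the rank of the integer matrix θ − I (its rank as a linear map ℤ² → ℤ², equivalently its rank over ℚ). -/
/-- The automorphism of `ℤ²` (written multiplicatively) induced by a matrix `θ ∈ GL(2, ℤ)`. -/
noncomputable def torusAut (θ : GL (Fin 2) ℤ) : MulAut (Multiplicative (Fin 2 → ℤ)) :=
  AddEquiv.toMultiplicative
    ((LinearMap.GeneralLinearGroup.generalLinearEquiv ℤ (Fin 2 → ℤ)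
      (Matrix.GeneralLinearGroup.toLin θ)).toAddEquiv)

/-- The action of `ℤ` on `ℤ²` in which the generator `1 ∈ ℤ` acts via `θ`. -/
noncomputable def torusAction (θ : GL (Fin 2) ℤ) :
    Multiplicative ℤ →* MulAut (Multiplicative (Fin 2 → ℤ)) :=
  zpowersHom _ (torusAut θ)

/-- The fundamental group `G = ℤ² ⋊_θ ℤ` of the torus bundle with monodromy `θ`. -/
noncomputable def TorusBundleGroup (θ : GL (Fin 2) ℤ) : Type :=
  SemidirectProduct (Multiplicative (Fin 2 → ℤ)) (Multiplicative ℤ) (torusAction θ)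

noncomputable instance (θ : GL (Fin 2) ℤ) : Group (TorusBundleGroup θ) :=
  inferInstanceAs (Group (SemidirectProduct _ _ _))

theorem int_rank_nullity (f : (Fin 2 → ℤ) →ₗ[ℤ] (Fin 2 → ℤ)) :
    Module.finrank ℤ (LinearMap.range f) + Module.finrank ℤ (LinearMap.ker f)
      = Module.finrank ℤ (Fin 2 → ℤ) := by
  rw [← f.quotKerEquivRange.finrank_eq, Submodule.finrank_quotient_add_finrank]

open Matrix in
theorem rank_le_rank_transpose_int (A : Matrix (Fin 2) (Fin 2) ℤ) : A.rank ≤ Aᵀ.rank := by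
  have hk : LinearMap.ker (Aᵀ * A).mulVecLin = LinearMap.ker A.mulVecLin := by
    ext x
    simp only [LinearMap.mem_ker, mulVecLin_apply, ← mulVec_mulVec]
    constructor
    · intro h
      replace h := congr_arg (dotProduct x) h
      rwa [dotProduct_mulVec, dotProduct_zero, vecMul_transpose, dotProduct_self_eq_zero] at h
    · intro h
      rw [h, mulVec_zero]
  have h1 := int_rank_nullity (Aᵀ * A).mulVecLin
  have h2 := int_rank_nullity A.mulVecLin
  rw [hk] at h1
  have h3 := rank_mul_le_left Aᵀ A
  unfold Matrix.rank at *
  omega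

open Matrix in
theorem finrank_ker_transpose_int (A : Matrix (Fin 2) (Fin 2) ℤ) :
    Module.finrank ℤ (LinearMap.ker Aᵀ.mulVecLin) + A.rank = 2 := by
  have h1 := int_rank_nullity Aᵀ.mulVecLin
  have h2 := rank_le_rank_transpose_int A
  have h3 := rank_le_rank_transpose_int Aᵀ
  rw [transpose_transpose] at h3
  simp only [Module.finrank_fin_fun] at h1
  unfold Matrix.rank at *
  omega

theorem torusAut_apply (θ : GL (Fin 2) ℤ) (n : Fin 2 → ℤ) :
    torusAut θ (Multiplicative.ofAdd n) =
      Multiplicative.ofAdd (Matrix.mulVec (θ : Matrix (Fin 2) (Fin 2) ℤ) n) := rfl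

open Matrix in
theorem torus_mem_ker_iff (θ : GL (Fin 2) ℤ) (v : Fin 2 → ℤ) :
    v ∈ LinearMap.ker ((θ : Matrix (Fin 2) (Fin 2) ℤ) - 1)ᵀ.mulVecLin ↔
      ∀ n : Fin 2 → ℤ, v ⬝ᵥ ((θ : Matrix (Fin 2) (Fin 2) ℤ) *ᵥ n) = v ⬝ᵥ n := by
  rw [LinearMap.mem_ker, mulVecLin_apply, mulVec_transpose, vecMul_sub, vecMul_one, sub_eq_zero]
  constructor
  · intro h n
    rw [dotProduct_mulVec, h]
  · intro h
    apply dotProduct_eq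
    intro n
    rw [← dotProduct_mulVec, h]

open Matrix in
theorem torusAction_invariant (θ : GL (Fin 2) ℤ) (v : Fin 2 → ℤ)
    (hv : ∀ n : Fin 2 → ℤ, v ⬝ᵥ ((θ : Matrix (Fin 2) (Fin 2) ℤ) *ᵥ n) = v ⬝ᵥ n)
    (z : Multiplicative ℤ) (n : Multiplicative (Fin 2 → ℤ)) :
    v ⬝ᵥ (torusAction θ z n).toAdd = v ⬝ᵥ n.toAdd := by
  have h0 : ∀ n : Multiplicative (Fin 2 → ℤ), v ⬝ᵥ (torusAut θ n).toAdd = v ⬝ᵥ n.toAdd :=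
    fun n => hv n.toAdd
  have key : ∀ (k : ℤ) (n : Multiplicative (Fin 2 → ℤ)),
      v ⬝ᵥ ((torusAut θ ^ k) n).toAdd = v ⬝ᵥ n.toAdd := by
    intro k
    induction k with
    | zero => intro n; simp
    | succ k ih => intro n; rw [_root_.zpow_add_one, MulAut.mul_apply, ih, h0]
    | pred k ih =>
      intro n
      rw [_root_.zpow_sub_one, MulAut.mul_apply, ih, ← h0, MulAut.apply_inv_self]
  exact key z.toAdd n

/-- The homomorphism `G → ℤ` attached to an invariant covector and an integer. -/
noncomputable def torusHom (θ : GL (Fin 2) ℤ) (v : Fin 2 → ℤ)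
    (hv : ∀ n : Fin 2 → ℤ, dotProduct v (Matrix.mulVec (θ : Matrix (Fin 2) (Fin 2) ℤ) n)
      = dotProduct v n) (t : ℤ) :
    Additive (TorusBundleGroup θ) →+ ℤ :=
  AddMonoidHom.mk' (fun g => dotProduct v (SemidirectProduct.left g.toMul).toAdd
      + t * (SemidirectProduct.right g.toMul).toAdd) (by
    intro a b
    have h1 : SemidirectProduct.left (a + b).toMul = SemidirectProduct.left a.toMul *
      torusAction θ (SemidirectProduct.right a.toMul) (SemidirectProduct.left b.toMul) := rfl
    have h2 : SemidirectProduct.right (a + b).toMul = SemidirectProduct.right a.toMul *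
      SemidirectProduct.right b.toMul := rfl
    rw [h1, h2, toAdd_mul, toAdd_mul, dotProduct_add, torusAction_invariant θ v hv]
    ring)

/-- The inclusion of `ℤ²`. -/
noncomputable def torusInl (θ : GL (Fin 2) ℤ) : (Fin 2 → ℤ) →+ Additive (TorusBundleGroup θ) :=
  MonoidHom.toAdditiveRight
    (SemidirectProduct.inl : Multiplicative (Fin 2 → ℤ) →* SemidirectProduct _ _ (torusAction θ))

/-- The inclusion of `ℤ`. -/
noncomputable def torusInr (θ : GL (Fin 2) ℤ) : ℤ →+ Additive (TorusBundleGroup θ) :=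
  MonoidHom.toAdditiveRight
    (SemidirectProduct.inr : Multiplicative ℤ →* SemidirectProduct _ _ (torusAction θ))

theorem torus_decomp (θ : GL (Fin 2) ℤ) (g : Additive (TorusBundleGroup θ)) :
    g = torusInl θ (SemidirectProduct.left g.toMul).toAdd
      + torusInr θ (SemidirectProduct.right g.toMul).toAdd :=
  (SemidirectProduct.inl_left_mul_inr_right
    (g.toMul : SemidirectProduct _ _ (torusAction θ))).symm

theorem torus_conj (θ : GL (Fin 2) ℤ) (n : Fin 2 → ℤ) :
    torusInl θ (Matrix.mulVec (θ : Matrix (Fin 2) (Fin 2) ℤ) n) + torusInr θ 1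
      = torusInr θ 1 + torusInl θ n := by
  have h := SemidirectProduct.inl_aut (φ := torusAction θ) (Multiplicative.ofAdd (1 : ℤ))
    (Multiplicative.ofAdd n)
  have h2 : torusAction θ (Multiplicative.ofAdd (1 : ℤ)) = torusAut θ := by
    simp [torusAction]
  rw [h2, torusAut_apply, map_inv, eq_mul_inv_iff_mul_eq] at h
  exact h

theorem torus_dot (w : (Fin 2 → ℤ) →+ ℤ) (n : Fin 2 → ℤ) :
    dotProduct (fun i => w (Pi.single i 1)) n = w n := by
  have : w n = w.toIntLinearMap n := rfl
  rw [this, LinearMap.pi_apply_eq_sum_univ]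
  simp only [dotProduct, smul_eq_mul]
  refine Finset.sum_congr rfl fun i _ => ?_
  rw [mul_comm]
  change _ * w _ = _ * w _
  congr 2
  funext j
  simp [Pi.single_apply, eq_comm]

/-- `Hom(G, ℤ)` is the product of the invariant covectors and `ℤ`. -/
noncomputable def torusHomEquiv (θ : GL (Fin 2) ℤ) :
    (Additive (TorusBundleGroup θ) →+ ℤ) ≃+
      (LinearMap.ker (Matrix.transpose ((θ : Matrix (Fin 2) (Fin 2) ℤ) - 1)).mulVecLin × ℤ) where
  toFun f := ⟨⟨fun i => f (torusInl θ (Pi.single i 1)), by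
    rw [torus_mem_ker_iff]
    intro n
    have h := torus_dot (f.comp (torusInl θ))
    simp only [AddMonoidHom.comp_apply] at h
    rw [h, h]
    have h2 := congrArg f (torus_conj θ n)
    rw [map_add, map_add, add_comm] at h2
    exact add_left_cancel h2⟩, f (torusInr θ 1)⟩
  invFun p := torusHom θ p.1.1 ((torus_mem_ker_iff θ _).1 p.1.2) p.2
  left_inv f := by
    refine AddMonoidHom.ext fun g => ?_
    change dotProduct _ (SemidirectProduct.left g.toMul).toAdd
      + _ * (SemidirectProduct.right g.toMul).toAdd = f g
    have h := torus_dot (f.comp (torusInl θ))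
    simp only [AddMonoidHom.comp_apply] at h
    conv_rhs => rw [torus_decomp θ g, map_add]
    congr 1
    · exact h _
    · rw [mul_comm, ← smul_eq_mul, ← map_zsmul, ← map_zsmul, smul_eq_mul, mul_one]
  right_inv p := by
    refine Prod.ext (Subtype.ext (funext fun i => ?_)) ?_
    · change dotProduct p.1.1 (Pi.single i 1) + p.2 * 0 = _
      simp
    · change dotProduct p.1.1 0 + p.2 * 1 = _
      simp
  map_add' f g := rfl

/-- `H¹(G, ℤ) ≅ ℤ^(3 - rank (θ - I))`. -/
theorem torusBundle_H1 (θ : GL (Fin 2) ℤ) (r : ℕ)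
    (hr : ((θ : Matrix (Fin 2) (Fin 2) ℤ) - 1).rank = r) :
    Nonempty ((groupCohomology (Rep.trivial ℤ (TorusBundleGroup θ) ℤ) 1) ≃+ (Fin (3 - r) → ℤ)) := by
  have e1 : (groupCohomology (Rep.trivial ℤ (TorusBundleGroup θ) ℤ) 1) ≃+
      (Additive (TorusBundleGroup θ) →+ ℤ) :=
    (groupCohomology.H1IsoOfIsTrivial
      (Rep.trivial ℤ (TorusBundleGroup θ) ℤ)).toLinearEquiv.toAddEquiv
  have hk := finrank_ker_transpose_int ((θ : Matrix (Fin 2) (Fin 2) ℤ) - 1)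
  have e2 := LinearEquiv.ofFinrankEq (R := ℤ)
    (LinearMap.ker (Matrix.transpose ((θ : Matrix (Fin 2) (Fin 2) ℤ) - 1)).mulVecLin × ℤ)
    (Fin (3 - r) → ℤ) (by
      rw [Module.finrank_prod, Module.finrank_fin_fun, Module.finrank_self]
      omega)
  exact ⟨(e1.trans (torusHomEquiv θ)).trans e2.toAddEquiv⟩
end

section
/- If the integer matrix θ − I has rank 1 and det θ = 1, then H²(G, ℤ) ≅ ℤ/gcd(β,γ) ⊕ ℤ ⊕ ℤ. -/
namespace TB

/-- Triangular numbers. -/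
def tri (a : ℤ) : ℤ := a * (a - 1) / 2

lemma two_tri (a : ℤ) : 2 * tri a = a * (a - 1) := by
  unfold tri
  exact Int.mul_ediv_cancel' (Int.even_mul_pred_self a).two_dvd

lemma tri_add (a b : ℤ) : tri (a + b) = tri a + tri b + a * b := by
  have h1 := two_tri (a + b)
  have h2 := two_tri a
  have h3 := two_tri b
  nlinarith

@[simp] lemma tri_zero : tri 0 = 0 := rfl
@[simp] lemma tri_one : tri 1 = 0 := rfl

/-- Heisenberg type group with commutator parameter `k`. -/
@[ext] structure H (k : ℤ) where
  a : ℤ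
  b : ℤ
  c : ℤ

namespace H
variable {k : ℤ}

instance : Mul (H k) := ⟨fun x y => ⟨x.a + y.a, x.b + y.b, x.c + y.c + k * x.b * y.a⟩⟩
instance : One (H k) := ⟨⟨0, 0, 0⟩⟩
instance : Inv (H k) := ⟨fun x => ⟨-x.a, -x.b, -x.c + k * x.b * x.a⟩⟩

@[simp] lemma mul_a (x y : H k) : (x * y).a = x.a + y.a := rfl
@[simp] lemma mul_b (x y : H k) : (x * y).b = x.b + y.b := rfl
@[simp] lemma mul_c (x y : H k) : (x * y).c = x.c + y.c + k * x.b * y.a := rfl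
@[simp] lemma one_a : (1 : H k).a = 0 := rfl
@[simp] lemma one_b : (1 : H k).b = 0 := rfl
@[simp] lemma one_c : (1 : H k).c = 0 := rfl
@[simp] lemma inv_a (x : H k) : (x⁻¹).a = -x.a := rfl
@[simp] lemma inv_b (x : H k) : (x⁻¹).b = -x.b := rfl
@[simp] lemma inv_c (x : H k) : (x⁻¹).c = -x.c + k * x.b * x.a := rfl

instance : Group (H k) := Group.ofLeftAxioms
  (fun x y z => by ext <;> simp <;> ring)
  (fun x => by ext <;> simp)
  (fun x => by ext <;> simp)

/-- Projection to `ℤ²`. -/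
def proj (x : H k) : Multiplicative (Fin 2 → ℤ) := Multiplicative.ofAdd ![x.a, x.b]

end H

/-- Matrix entries with determinant one, and parameters of the extension. -/
structure Par where
  (α β γ δ : ℤ)
  (hdet : α * δ - β * γ = 1)

/-- The quadratic correction. -/
def Par.Q (p : Par) (k m n a b : ℤ) : ℤ :=
  k * (p.α * p.β * tri a + p.γ * p.δ * tri b + p.β * p.γ * (a * b)) + m * a + n * b

/-- The lifted automorphism of the Heisenberg group. -/
def Par.aut (p : Par) (k m n : ℤ) : MulAut (H k) where
  toFun x := ⟨p.α * x.a + p.γ * x.b, p.β * x.a + p.δ * x.b, x.c + p.Q k m n x.a x.b⟩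
  invFun x := ⟨p.δ * x.a - p.γ * x.b, -p.β * x.a + p.α * x.b,
    x.c - p.Q k m n (p.δ * x.a - p.γ * x.b) (-p.β * x.a + p.α * x.b)⟩
  left_inv x := by
    have h := p.hdet
    have e1 : p.δ * (p.α * x.a + p.γ * x.b) - p.γ * (p.β * x.a + p.δ * x.b) = x.a := by
      linear_combination x.a * h
    have e2 : -p.β * (p.α * x.a + p.γ * x.b) + p.α * (p.β * x.a + p.δ * x.b) = x.b := by
      linear_combination x.b * h
    ext
    · exact e1
    · exact e2
    · simp only [e1, e2]; ring
  right_inv x := by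
    have h := p.hdet
    ext
    · simp only; linear_combination x.a * h
    · simp only; linear_combination x.b * h
    · simp only; ring
  map_mul' x y := by
    have h := p.hdet
    ext
    · simp only [H.mul_a, H.mul_b]; ring
    · simp only [H.mul_a, H.mul_b]; ring
    · simp only [H.mul_a, H.mul_b, H.mul_c, Par.Q, tri_add]
      linear_combination (- k * x.b * y.a) * h

lemma Par.aut_apply (p : Par) (k m n : ℤ) (x : H k) : p.aut k m n x =
    ⟨p.α * x.a + p.γ * x.b, p.β * x.a + p.δ * x.b, x.c + p.Q k m n x.a x.b⟩ := rfl

open Multiplicative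

section grp
variable {K : Type*} [Group K]

lemma swap_zpow {x y z : K} (hx : Commute z x) (hy : Commute z y) (h : y * x = x * y * z)
    (a b : ℤ) : y ^ b * x ^ a = x ^ a * y ^ b * z ^ (b * a) := by
  have h1 : SemiconjBy y x (x * z) := by
    rw [SemiconjBy, h, mul_assoc, mul_assoc, hy.eq]
  have h2 := (h1.zpow_right a).eq
  rw [hx.symm.mul_zpow] at h2
  have h3 : SemiconjBy (x ^ a) (z ^ a * y) y := by
    rw [SemiconjBy, h2, mul_assoc]
  have h4 := (h3.zpow_right b).eq
  rw [(hy.zpow_left a).mul_zpow, ← zpow_mul, mul_comm a b, (hy.zpow_zpow _ _).eq,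
    ← mul_assoc] at h4
  exact h4.symm

/-- The hom from the Heisenberg group. -/
def hHom (k : ℤ) (x y z : K) (hx : Commute z x) (hy : Commute z y)
    (h : y * x = x * y * z ^ k) : H k →* K where
  toFun u := x ^ u.a * y ^ u.b * z ^ u.c
  map_one' := by simp
  map_mul' u v := by
    have h2 := swap_zpow (hx.zpow_left k) (hy.zpow_left k) h v.a u.b
    have c1 := fun i j => (hx.zpow_zpow i j).eq
    have c2 := fun i j => (hy.zpow_zpow i j).eq
    simp only [H.mul_a, H.mul_b, H.mul_c, zpow_add]
    rw [← zpow_mul, ← mul_assoc k] at h2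
    symm
    calc x ^ u.a * y ^ u.b * z ^ u.c * (x ^ v.a * y ^ v.b * z ^ v.c)
        = x ^ u.a * y ^ u.b * (z ^ u.c * x ^ v.a) * y ^ v.b * z ^ v.c := by group
      _ = x ^ u.a * (y ^ u.b * x ^ v.a) * (z ^ u.c * y ^ v.b) * z ^ v.c := by rw [c1]; group
      _ = x ^ u.a * x ^ v.a * y ^ u.b * (z ^ (k * u.b * v.a) * y ^ v.b) * (z ^ u.c * z ^ v.c) := by
          rw [c2, h2]; group
      _ = _ := by rw [c2]; group

lemma aut_mul_of (k : ℤ) (φ : MulAut (H k)) (σ : H k →* K) (t : K)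
    (h : ∀ u, σ (φ u) = t * σ u * t⁻¹) (i : ℤ) : ∀ u, σ ((φ ^ i) u) = t ^ i * σ u * (t ^ i)⁻¹ := by
  induction i with
  | zero => simp
  | succ i ih => 
    intro u
    rw [zpow_add_one, zpow_add_one, MulAut.mul_apply, ih, h]; group
  | pred i ih =>
    intro u
    have h' : σ (φ⁻¹ u) = t⁻¹ * σ u * t := by
      have := h (φ⁻¹ u)
      rw [MulAut.apply_inv_self] at this
      rw [this]; group
    rw [zpow_sub_one, zpow_sub_one, MulAut.mul_apply, ih, h']; group

end grp

/-- The extension group. -/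
abbrev E (p : Par) (k m n : ℤ) := SemidirectProduct (H k) (Multiplicative ℤ) (zpowersHom _ (p.aut k m n))

theorem exists_hom {K : Type*} [Group K] (p : Par) (k m n : ℤ) (x y t z : K)
    (hx : Commute z x) (hy : Commute z y) (ht : Commute z t) (h : y * x = x * y * z ^ k)
    (htx : t * x = x ^ p.α * y ^ p.β * z ^ m * t) (hty : t * y = x ^ p.γ * y ^ p.δ * z ^ n * t) :
    ∃ τ : E p k m n →* K, ∀ u : E p k m n, τ u =
      x ^ u.left.a * y ^ u.left.b * z ^ u.left.c * t ^ (u.right.toAdd) := by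
  let σ := hHom k x y z hx hy h
  have hσ : ∀ u, σ u = x ^ u.a * y ^ u.b * z ^ u.c := fun u => rfl
  let σ1 : H k →* K := σ.comp (p.aut k m n).toMonoidHom
  let σ2 : H k →* K := (MulAut.conj t).toMonoidHom.comp σ
  have hσ1 : ∀ u, σ1 u = σ (p.aut k m n u) := fun _ => rfl
  have hσ2 : ∀ u, σ2 u = t * σ u * t⁻¹ := fun _ => rfl
  have gen : ∀ u : H k, u = (⟨1,0,0⟩ : H k) ^ u.a * (⟨0,1,0⟩ : H k) ^ u.b * (⟨0,0,1⟩ : H k) ^ u.c := by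
    have g1 : ∀ i : ℤ, (⟨1,0,0⟩ : H k) ^ i = ⟨i,0,0⟩ := by
      intro i
      induction i with
      | zero => rfl
      | succ i ih => rw [zpow_add_one, ih]; ext <;> simp
      | pred i ih => rw [zpow_sub_one, ih]; ext <;> simp <;> ring
    have g2 : ∀ i : ℤ, (⟨0,1,0⟩ : H k) ^ i = ⟨0,i,0⟩ := by
      intro i
      induction i with
      | zero => rfl
      | succ i ih => rw [zpow_add_one, ih]; ext <;> simp
      | pred i ih => rw [zpow_sub_one, ih]; ext <;> simp <;> ring
    have g3 : ∀ i : ℤ, (⟨0,0,1⟩ : H k) ^ i = ⟨0,0,i⟩ := by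
      intro i
      induction i with
      | zero => rfl
      | succ i ih => rw [zpow_add_one, ih]; ext <;> simp
      | pred i ih => rw [zpow_sub_one, ih]; ext <;> simp <;> ring
    intro u
    rw [g1, g2, g3]; ext <;> simp
  have e : ∀ u, σ1 u = σ2 u := by
    intro u
    rw [gen u]
    simp only [map_mul, map_zpow]
    have e1 : σ1 ⟨1,0,0⟩ = σ2 ⟨1,0,0⟩ := by
      rw [hσ1, hσ2, Par.aut_apply, hσ, hσ]
      simp [Par.Q, htx]
    have e2 : σ1 ⟨0,1,0⟩ = σ2 ⟨0,1,0⟩ := by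
      rw [hσ1, hσ2, Par.aut_apply, hσ, hσ]
      simp [Par.Q, hty]
    have e3 : σ1 ⟨0,0,1⟩ = σ2 ⟨0,0,1⟩ := by
      rw [hσ1, hσ2, Par.aut_apply, hσ, hσ]
      simp [Par.Q, ← ht.eq]
    rw [e1, e2, e3]
  refine ⟨SemidirectProduct.lift σ (zpowersHom _ t) ?_, ?_⟩
  · intro g
    ext u
    exact aut_mul_of k _ σ t (fun u => e u) g.toAdd u
  · intro u
    rfl

end TB

namespace TB
open Multiplicative

abbrev N := Multiplicative (Fin 2 → ℤ)

/-- `T` acts by the matrix of `p`. -/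
def Acts (p : Par) (T : MulAut N) : Prop :=
  ∀ a b : ℤ, T (ofAdd ![a, b]) = ofAdd ![p.α * a + p.γ * b, p.β * a + p.δ * b]

abbrev G0 (T : MulAut N) := SemidirectProduct N (Multiplicative ℤ) (zpowersHom _ T)

lemma N_eta (v : N) : v = ofAdd ![v.toAdd 0, v.toAdd 1] := by
  apply toAdd.injective
  funext i
  fin_cases i <;> rfl

/-- projection hom -/
def projHom (k : ℤ) : H k →* N where
  toFun x := ofAdd ![x.a, x.b]
  map_one' := by
    apply toAdd.injective
    funext i
    fin_cases i <;> rfl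
  map_mul' x y := by
    apply toAdd.injective
    funext i
    fin_cases i <;> rfl

lemma projHom_apply (k : ℤ) (x : H k) : projHom k x = ofAdd ![x.a, x.b] := rfl

lemma zpow_equivariant {A B : Type*} [Group A] [Group B] (φ : MulAut A) (T : MulAut B) (σ : A →* B)
    (h : ∀ u, σ (φ u) = T (σ u)) (i : ℤ) : ∀ u, σ ((φ ^ i) u) = (T ^ i) (σ u) := by
  induction i with
  | zero => simp
  | succ i ih =>
    intro u
    rw [zpow_add_one, zpow_add_one, MulAut.mul_apply, ih, h, MulAut.mul_apply]
  | pred i ih =>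
    intro u
    have h' : σ (φ⁻¹ u) = T⁻¹ (σ u) := by
      have := h (φ⁻¹ u)
      rw [MulAut.apply_inv_self] at this
      rw [this, MulAut.inv_apply_self]
    rw [zpow_sub_one, zpow_sub_one, MulAut.mul_apply, ih, h', MulAut.mul_apply]

lemma zpow_invariant {A B : Type*} [Group A] (φ : MulAut A) (σ : A → B)
    (h : ∀ u, σ (φ u) = σ u) (i : ℤ) : ∀ u, σ ((φ ^ i) u) = σ u := by
  induction i with
  | zero => simp
  | succ i ih =>
    intro u
    rw [zpow_add_one, MulAut.mul_apply, ih, h]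
  | pred i ih =>
    intro u
    have h' : σ (φ⁻¹ u) = σ u := by
      have := h (φ⁻¹ u)
      rw [MulAut.apply_inv_self] at this
      rw [this]
    rw [zpow_sub_one, MulAut.mul_apply, ih, h']

section

lemma proj_zpow {p : Par} {T : MulAut N} (hT : Acts p T) (k m n i : ℤ) (u : H k) :
    projHom k (((p.aut k m n) ^ i) u) = (T ^ i) (projHom k u) := by
  apply zpow_equivariant
  intro u
  rw [projHom_apply, projHom_apply, hT]
  rfl

end

/-- Central elements. -/
def iota (p : Par) (k m n c : ℤ) : E p k m n := SemidirectProduct.inl ⟨0, 0, c⟩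

/-- The set-theoretic section. -/
def sec (p : Par) (T : MulAut N) (k m n : ℤ) (g : G0 T) : E p k m n :=
  ⟨⟨g.left.toAdd 0, g.left.toAdd 1, 0⟩, g.right⟩

/-- The cocycle. -/
def F (p : Par) (T : MulAut N) (k m n : ℤ) (g h : G0 T) : ℤ :=
  (sec p T k m n g * sec p T k m n h).left.c

lemma iota_mul_iota (p : Par) (k m n c d : ℤ) :
    iota p k m n c * iota p k m n d = iota p k m n (c + d) := by
  unfold iota
  rw [← map_mul]; congr 1; ext <;> simp

lemma iota_mul (p : Par) (k m n c : ℤ) (u : E p k m n) :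
    iota p k m n c * u = ⟨⟨u.left.a, u.left.b, c + u.left.c⟩, u.right⟩ := by
  unfold iota
  ext <;> simp

lemma iota_comm (p : Par) (k m n c : ℤ) (u : E p k m n) :
    u * iota p k m n c = iota p k m n c * u := by
  have : ∀ i : ℤ, ((p.aut k m n) ^ i) ⟨0, 0, c⟩ = ⟨0, 0, c⟩ := by
    intro i
    have h0 : p.aut k m n ⟨0, 0, c⟩ = ⟨0, 0, c⟩ := by
      rw [Par.aut_apply]; simp [Par.Q]
    have h1 : (p.aut k m n)⁻¹ ⟨0, 0, c⟩ = ⟨0, 0, c⟩ := by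
      nth_rw 1 [← h0]
      rw [MulAut.inv_apply_self]
    induction i with
    | zero => rfl
    | succ i ih => rw [zpow_add_one, MulAut.mul_apply, h0, ih]
    | pred i ih => rw [zpow_sub_one, MulAut.mul_apply, h1, ih]
  rw [iota_mul]
  have h3 : (u * iota p k m n c).left = u.left * ((p.aut k m n) ^ u.right.toAdd) ⟨0, 0, c⟩ := rfl
  rw [this] at h3
  ext
  · rw [h3]; simp
  · rw [h3]; simp
  · rw [h3]; simp; ring
  · simp [iota]

section

lemma sec_mul {p : Par} {T : MulAut N} (hT : Acts p T) (k m n : ℤ) (g h : G0 T) :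
    sec p T k m n g * sec p T k m n h
      = iota p k m n (F p T k m n g h) * sec p T k m n (g * h) := by
  have e : projHom k (sec p T k m n g * sec p T k m n h).left = (g * h).left := by
    have h3 : (sec p T k m n g * sec p T k m n h).left
      = (sec p T k m n g).left * ((p.aut k m n) ^ g.right.toAdd) (sec p T k m n h).left := rfl
    rw [h3, map_mul, proj_zpow hT]
    have e1 : ∀ g, projHom k (sec p T k m n g).left = g.left := fun g => (N_eta g.left).symm
    rw [e1, e1]
    rfl
  rw [iota_mul]
  ext
  · have := congrArg (fun v : N => v.toAdd 0) e
    exact this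
  · have := congrArg (fun v : N => v.toAdd 1) e
    exact this
  · simp [F, sec]
  · rfl

lemma F_cocycle {p : Par} {T : MulAut N} (hT : Acts p T) (k m n : ℤ) (g h j : G0 T) :
    F p T k m n (g * h) j + F p T k m n g h = F p T k m n h j + F p T k m n g (h * j) := by
  have e := mul_assoc (sec p T k m n g) (sec p T k m n h) (sec p T k m n j)
  rw [sec_mul hT k m n g h, sec_mul hT k m n h j, mul_assoc, sec_mul hT k m n (g * h) j,
    ← mul_assoc (sec p T k m n g), iota_comm, mul_assoc (iota p k m n _) (sec p T k m n g),
    sec_mul hT k m n g (h * j), ← mul_assoc, ← mul_assoc, iota_mul_iota, iota_mul_iota,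
    mul_assoc g, iota_mul, iota_mul] at e
  have := congrArg (fun u : E p k m n => u.left.c) e
  simp only at this
  linarith

lemma F_eq {p : Par} {T : MulAut N} (hT : Acts p T) (k m n : ℤ) (g h : G0 T) : F p T k m n g h =
    (((p.aut k m n) ^ g.right.toAdd) ⟨h.left.toAdd 0, h.left.toAdd 1, 0⟩).c
      + k * g.left.toAdd 1 * ((T ^ g.right.toAdd) h.left).toAdd 0 := by
  have h1 := proj_zpow hT k m n g.right.toAdd ⟨h.left.toAdd 0, h.left.toAdd 1, 0⟩
  rw [projHom_apply k ⟨h.left.toAdd 0, h.left.toAdd 1, 0⟩] at h1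
  simp only [← N_eta] at h1
  rw [← h1]
  have h3 : F p T k m n g h = ((sec p T k m n g).left * ((p.aut k m n) ^ g.right.toAdd) (sec p T k m n h).left).c := rfl
  rw [h3, H.mul_c]
  simp [sec, projHom_apply]

end

lemma aut_symm (p : Par) (k m n a b c : ℤ) : (p.aut k m n)⁻¹ ⟨a, b, c⟩ =
    ⟨p.δ * a - p.γ * b, -p.β * a + p.α * b,
    c - p.Q k m n (p.δ * a - p.γ * b) (-p.β * a + p.α * b)⟩ := rfl

lemma c_add (p : Par) (k m n k' m' n' i : ℤ) : ∀ a b c c' : ℤ,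
    (((p.aut (k + k') (m + m') (n + n')) ^ i) ⟨a, b, c + c'⟩).c =
    (((p.aut k m n) ^ i) ⟨a, b, c⟩).c + (((p.aut k' m' n') ^ i) ⟨a, b, c'⟩).c := by
  have hQ : ∀ a b, p.Q (k + k') (m + m') (n + n') a b = p.Q k m n a b + p.Q k' m' n' a b := by
    intro a b; unfold Par.Q; ring
  induction i with
  | zero => intros; rfl
  | succ i ih =>
    intro a b c c'
    simp only [zpow_add_one, MulAut.mul_apply, Par.aut_apply]
    rw [← ih, hQ]
    congr 3; ring
  | pred i ih =>
    intro a b c c'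
    simp only [zpow_sub_one, MulAut.mul_apply, aut_symm]
    rw [← ih, hQ]
    congr 3; ring

section

lemma F_add {p : Par} {T : MulAut N} (hT : Acts p T) (k m n k' m' n' : ℤ) (g h : G0 T) :
    F p T (k + k') (m + m') (n + n') g h = F p T k m n g h + F p T k' m' n' g h := by
  have := c_add p k m n k' m' n' g.right.toAdd (h.left.toAdd 0) (h.left.toAdd 1) 0 0
  rw [F_eq hT, F_eq hT, F_eq hT]
  simp only [add_zero] at this
  rw [this]; ring

lemma F_coboundary {p : Par} {T : MulAut N} (hT : Acts p T) (l1 l2 : ℤ) (g h : G0 T) :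
    F p T 0 (l1 - (p.α * l1 + p.β * l2)) (l2 - (p.γ * l1 + p.δ * l2)) g h =
      (h.left.toAdd 0 * l1 + h.left.toAdd 1 * l2)
      - ((g * h).left.toAdd 0 * l1 + (g * h).left.toAdd 1 * l2)
      + (g.left.toAdd 0 * l1 + g.left.toAdd 1 * l2) := by
  set m := (l1 - (p.α * l1 + p.β * l2))
  set n := (l2 - (p.γ * l1 + p.δ * l2))
  have h1 := zpow_invariant (p.aut 0 m n) (fun u => u.c + (u.a * l1 + u.b * l2)) (by
    intro u
    rw [Par.aut_apply]
    simp only [Par.Q, m, n]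
    ring) g.right.toAdd ⟨h.left.toAdd 0, h.left.toAdd 1, 0⟩
  have h2 := proj_zpow hT 0 m n g.right.toAdd ⟨h.left.toAdd 0, h.left.toAdd 1, 0⟩
  rw [projHom_apply 0 ⟨h.left.toAdd 0, h.left.toAdd 1, 0⟩] at h2
  simp only [← N_eta] at h2
  have h3 := congrArg (fun v : N => v.toAdd 0) h2
  have h4 := congrArg (fun v : N => v.toAdd 1) h2
  simp only [projHom_apply, toAdd_ofAdd, Matrix.cons_val_zero, Matrix.cons_val_one] at h3 h4
  rw [F_eq hT]
  have h5 : (g * h).left = g.left * (T ^ g.right.toAdd) h.left := rfl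
  rw [h5]
  simp only [toAdd_mul, Pi.add_apply] at *
  rw [← h3, ← h4]
  linarith

lemma coboundary_F {p : Par} {T : MulAut N} (hT : Acts p T) (k m n : ℤ) (f : G0 T → ℤ)
    (hf : ∀ g h, F p T k m n g h = f h - f (g * h) + f g) :
    k = 0 ∧ ∃ l1 l2, m = l1 - (p.α * l1 + p.β * l2) ∧ n = l2 - (p.γ * l1 + p.δ * l2) := by
  have inl_inl : ∀ v w : N, F p T k m n (SemidirectProduct.inl v) (SemidirectProduct.inl w) =
      k * v.toAdd 1 * w.toAdd 0 := by
    intro v w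
    rw [F_eq hT]
    simp
  have inl_inr : ∀ (v : N) i, F p T k m n (SemidirectProduct.inl v) (SemidirectProduct.inr i) = 0 := by
    intro v w
    rw [F_eq hT]
    simp
  have hk : k = 0 := by
    have h1 := hf (SemidirectProduct.inl (ofAdd ![0, 1])) (SemidirectProduct.inl (ofAdd ![1, 0]))
    have h2 := hf (SemidirectProduct.inl (ofAdd ![1, 0])) (SemidirectProduct.inl (ofAdd ![0, 1]))
    rw [inl_inl, ← map_mul] at h1 h2
    rw [mul_comm (ofAdd ![0, 1] : N)] at h1
    simp [-map_mul] at h1 h2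
    linarith
  refine ⟨hk, ?_⟩
  subst hk
  let l : (Fin 2 → ℤ) →+ ℤ := AddMonoidHom.mk' (fun v => f (SemidirectProduct.inl (ofAdd v))) (by
    intro v w
    have := hf (SemidirectProduct.inl (ofAdd v)) (SemidirectProduct.inl (ofAdd w))
    rw [inl_inl, ← map_mul, ← ofAdd_add] at this
    simp only [zero_mul] at this
    linarith)
  have hl : ∀ v, f (SemidirectProduct.inl (ofAdd v)) = l v := fun _ => rfl
  have hl2 : ∀ a b : ℤ, l ![a, b] = a * l ![1, 0] + b * l ![0, 1] := by
    intro a b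
    have : (![a, b] : Fin 2 → ℤ) = a • ![1, 0] + b • ![0, 1] := by
      funext i; fin_cases i <;> simp
    rw [this, map_add, map_zsmul, map_zsmul]; simp
  have key : ∀ a b : ℤ, m * a + n * b = l ![a, b] - l ![p.α * a + p.γ * b, p.β * a + p.δ * b] := by
    intro a b
    have h1 := hf (SemidirectProduct.inr (ofAdd 1)) (SemidirectProduct.inl (ofAdd ![a, b]))
    have h2 := hf (SemidirectProduct.inl (T (ofAdd ![a, b]))) (SemidirectProduct.inr (ofAdd 1))
    rw [inl_inr] at h2
    have h3 : (SemidirectProduct.inr (ofAdd 1) * SemidirectProduct.inl (ofAdd ![a, b]) : G0 T) =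
      SemidirectProduct.inl (T (ofAdd ![a, b])) * SemidirectProduct.inr (ofAdd 1) := by
      ext1 <;> simp
    rw [h3, F_eq hT] at h1
    simp only [SemidirectProduct.right_inr, toAdd_ofAdd, zpow_one, Par.aut_apply] at h1
    rw [hT, hl] at h2
    rw [hT, hl] at h1
    simp [Par.Q] at h1
    linarith
  refine ⟨l ![1, 0], l ![0, 1], ?_, ?_⟩
  · have := key 1 0
    rw [hl2 (_ + _)] at this
    simp at this
    linarith
  · have := key 0 1
    rw [hl2 (_ + _)] at this
    simp at this
    linarith

end

end TB

namespace TB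
open Multiplicative

/-- A normalised-free trivial-coefficient two-cocycle. -/
structure Coc (G : Type*) [Group G] where
  f : G → G → ℤ
  hf : ∀ g h j, f (g * h) j + f g h = f h j + f g (h * j)

/-- The central extension attached to a cocycle. -/
@[ext] structure Ext {G : Type*} [Group G] (f : Coc G) where
  r : ℤ
  g : G

section
variable {G : Type*} [Group G] {f : Coc G}

lemma Coc.one_left (f : Coc G) (g : G) : f.f 1 g = f.f 1 1 := by
  have := f.hf 1 1 g
  simp only [one_mul] at this
  linarith

lemma Coc.one_right (f : Coc G) (g : G) : f.f g 1 = f.f 1 1 := by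
  have := f.hf g 1 1
  simp only [one_mul, mul_one] at this
  linarith

instance : Mul (Ext f) := ⟨fun x y => ⟨x.r + y.r + f.f x.g y.g, x.g * y.g⟩⟩
instance : One (Ext f) := ⟨⟨-f.f 1 1, 1⟩⟩
instance : Inv (Ext f) := ⟨fun x => ⟨-x.r - f.f x.g⁻¹ x.g - f.f 1 1, x.g⁻¹⟩⟩

@[simp] lemma Ext.mul_r (x y : Ext f) : (x * y).r = x.r + y.r + f.f x.g y.g := rfl
@[simp] lemma Ext.mul_g (x y : Ext f) : (x * y).g = x.g * y.g := rfl
@[simp] lemma Ext.one_r : (1 : Ext f).r = - f.f 1 1 := rfl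
@[simp] lemma Ext.one_g : (1 : Ext f).g = 1 := rfl
@[simp] lemma Ext.inv_r (x : Ext f) : (x⁻¹).r = -x.r - f.f x.g⁻¹ x.g - f.f 1 1 := rfl
@[simp] lemma Ext.inv_g (x : Ext f) : (x⁻¹).g = x.g⁻¹ := rfl

instance : Group (Ext f) := Group.ofLeftAxioms
  (fun x y z => by
    ext
    · simp only [Ext.mul_r, Ext.mul_g]
      have := f.hf x.g y.g z.g
      linarith
    · simp [mul_assoc])
  (fun x => by
    ext
    · simp only [Ext.mul_r, Ext.one_r, Ext.one_g, f.one_left]; ring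
    · simp)
  (fun x => by
    ext
    · simp only [Ext.mul_r, Ext.one_r, Ext.inv_r, Ext.inv_g]; ring
    · simp)

/-- projection -/
def Ext.pi (f : Coc G) : Ext f →* G where
  toFun x := x.g
  map_one' := rfl
  map_mul' _ _ := rfl

/-- The central generator. -/
def Ext.z (f : Coc G) : Ext f := ⟨1 - f.f 1 1, 1⟩

lemma Ext.z_zpow (c : ℤ) : (Ext.z f) ^ c = ⟨c - f.f 1 1, 1⟩ := by
  induction c with
  | zero => ext <;> simp
  | succ i ih =>
    rw [zpow_add_one, ih]
    ext
    · simp [Ext.z]; ring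
    · simp [Ext.z]
  | pred i ih =>
    rw [zpow_sub_one, ih]
    ext
    · simp [Ext.z]; ring
    · simp [Ext.z]

lemma Ext.z_zpow_mul (c : ℤ) (u : Ext f) : (Ext.z f) ^ c * u = ⟨c + u.r, u.g⟩ := by
  rw [Ext.z_zpow]
  ext
  · simp [f.one_left]; ring
  · simp

lemma Ext.mul_z_zpow (c : ℤ) (u : Ext f) : u * (Ext.z f) ^ c = ⟨c + u.r, u.g⟩ := by
  rw [Ext.z_zpow]
  ext
  · simp [f.one_right]; ring
  · simp

lemma Ext.z_comm (u : Ext f) : Commute (Ext.z f) u := by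
  have h1 := Ext.z_zpow_mul 1 u
  have h2 := Ext.mul_z_zpow 1 u
  rw [zpow_one] at h1 h2
  exact h1.trans h2.symm

lemma Ext.exists_z {u w : Ext f} (h : u.g = w.g) : ∃ c : ℤ, u = w * (Ext.z f) ^ c := by
  refine ⟨u.r - w.r, ?_⟩
  rw [Ext.mul_z_zpow]
  ext
  · simp
  · exact h

end

section

lemma word_eq {T : MulAut N} (a b i : ℤ) :
    (SemidirectProduct.inl (ofAdd ![1, 0]) : G0 T) ^ a * SemidirectProduct.inl (ofAdd ![0, 1]) ^ b
      * SemidirectProduct.inr (ofAdd 1) ^ i = ⟨ofAdd ![a, b], ofAdd i⟩ := by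
  rw [← map_zpow SemidirectProduct.inl, ← map_zpow SemidirectProduct.inl,
    ← map_zpow SemidirectProduct.inr, ← map_mul SemidirectProduct.inl, SemidirectProduct.mk_eq_inl_mul_inr,
    ← ofAdd_zsmul, ← ofAdd_zsmul, ← ofAdd_zsmul, ← ofAdd_add]
  congr 3
  · congr 1
    funext i; fin_cases i <;> simp
  · simp

theorem F_surj {p : Par} {T : MulAut N} (hT : Acts p T) (f : Coc (G0 T)) : ∃ k m n : ℤ, ∃ h : G0 T → ℤ, ∀ g g',
    F p T k m n g g' - f.f g g' = h g' - h (g * g') + h g := by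
  let X : G0 T := SemidirectProduct.inl (ofAdd ![1, 0])
  let Y : G0 T := SemidirectProduct.inl (ofAdd ![0, 1])
  let t : G0 T := SemidirectProduct.inr (ofAdd 1)
  have hw : ∀ a b i : ℤ, X ^ a * Y ^ b * t ^ i = ⟨ofAdd ![a, b], ofAdd i⟩ := word_eq
  let x : Ext f := ⟨0, X⟩
  let y : Ext f := ⟨0, Y⟩
  let s : Ext f := ⟨0, t⟩
  have px : Ext.pi f x = X := rfl
  have py : Ext.pi f y = Y := rfl
  have ps : Ext.pi f s = t := rfl
  have pz : Ext.pi f (Ext.z f) = 1 := rfl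
  obtain ⟨k, hk⟩ : ∃ k : ℤ, y * x = x * y * (Ext.z f) ^ k := by
    apply Ext.exists_z
    change Y * X = X * Y
    simp only [X, Y]
    rw [← map_mul SemidirectProduct.inl, ← map_mul SemidirectProduct.inl, mul_comm]
  have tv : ∀ a b : ℤ, t * SemidirectProduct.inl (ofAdd ![a, b]) =
      X ^ (p.α * a + p.γ * b) * Y ^ (p.β * a + p.δ * b) * t := by
    intro a b
    have := hw (p.α * a + p.γ * b) (p.β * a + p.δ * b) 1
    rw [zpow_one] at this
    rw [this, ← hT]
    ext1 <;> simp [t]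
  obtain ⟨m, hm⟩ : ∃ m : ℤ, s * x = x ^ p.α * y ^ p.β * s * (Ext.z f) ^ m := by
    apply Ext.exists_z
    change t * X = Ext.pi f (x ^ p.α * y ^ p.β * s)
    simp only [map_mul, map_zpow, px, py, ps]
    have := tv 1 0
    simpa using this
  obtain ⟨n, hn⟩ : ∃ n : ℤ, s * y = x ^ p.γ * y ^ p.δ * s * (Ext.z f) ^ n := by
    apply Ext.exists_z
    change t * Y = Ext.pi f (x ^ p.γ * y ^ p.δ * s)
    simp only [map_mul, map_zpow, px, py, ps]
    have := tv 0 1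
    simpa using this
  rw [mul_assoc, ← ((Ext.z_comm s).zpow_left _).eq, ← mul_assoc] at hm hn
  obtain ⟨τ, hτ⟩ := exists_hom p k m n x y s (Ext.z f) (Ext.z_comm x) (Ext.z_comm y)
    (Ext.z_comm s) hk hm hn
  have hι : ∀ c, τ (iota p k m n c) = (Ext.z f) ^ c := by
    intro c
    rw [hτ]; simp [iota]
  have hg : ∀ g, (τ (sec p T k m n g)).g = g := by
    intro g
    change Ext.pi f (τ (sec p T k m n g)) = g
    rw [hτ]
    simp only [map_mul, map_zpow, px, py, ps, pz, one_zpow, mul_one, hw]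
    ext1
    · exact (N_eta g.left).symm
    · rfl
  refine ⟨k, m, n, fun g => (τ (sec p T k m n g)).r, fun g g' => ?_⟩
  have h1 := congrArg (fun u => (τ u).r) (sec_mul hT k m n g g')
  simp only [map_mul, hι, Ext.z_zpow_mul] at h1
  rw [Ext.mul_r, hg, hg] at h1
  linarith

end

section final
variable {p : Par} {T : MulAut N}
open groupCohomology

lemma mem_cob {G : Type} [Group G] (f : G × G → ℤ) :
    f ∈ coboundaries₂ (Rep.trivial ℤ G ℤ) ↔ ∃ h : G → ℤ, ∀ a b, f (a, b) = h b - h (a * b) + h a := by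
  constructor
  · rintro ⟨h, rfl⟩
    exact ⟨h, fun a b => rfl⟩
  · rintro ⟨h, hh⟩
    exact ⟨h, funext fun ⟨a, b⟩ => (hh a b).symm⟩

lemma mem_coc {G : Type} [Group G] (f : G × G → ℤ) :
    f ∈ cocycles₂ (Rep.trivial ℤ G ℤ) ↔
      ∀ g h j, f (g * h, j) + f (g, h) = f (h, j) + f (g, h * j) :=
  mem_cocycles₂_iff (A := Rep.trivial ℤ G ℤ) f

/-- The cocycle as an element of `Z²`. -/
def FC (hT : Acts p T) (x : ℤ × ℤ × ℤ) : cocycles₂ (Rep.trivial ℤ (G0 T) ℤ) :=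
  ⟨fun g => F p T x.1 x.2.1 x.2.2 g.1 g.2, (mem_coc _).2 (F_cocycle hT _ _ _)⟩

/-- The comparison map. -/
noncomputable def Psi (hT : Acts p T) : ℤ × ℤ × ℤ →+ groupCohomology (Rep.trivial ℤ (G0 T) ℤ) 2 :=
  AddMonoidHom.mk' (fun x => H2π (Rep.trivial ℤ (G0 T) ℤ) (FC hT x)) (by
    intro x y
    rw [← map_add]
    congr 1
    apply Subtype.ext
    funext g
    exact F_add hT _ _ _ _ _ _ _ _)

lemma Psi_surj (hT : Acts p T) : Function.Surjective (Psi hT) := by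
  intro x
  induction x using H2_induction_on with
  | h f =>
    obtain ⟨k, m, n, h, hh⟩ := F_surj hT ⟨fun a b => f (a, b), (mem_coc _).1 f.2⟩
    refine ⟨(k, m, n), ?_⟩
    refine (H2π_eq_iff _ _).2 ?_
    exact (mem_cob _).2 ⟨h, hh⟩

lemma Psi_ker (hT : Acts p T) (x : ℤ × ℤ × ℤ) : Psi hT x = 0 ↔
    x.1 = 0 ∧ ∃ l1 l2, x.2.1 = l1 - (p.α * l1 + p.β * l2) ∧
      x.2.2 = l2 - (p.γ * l1 + p.δ * l2) := by
  refine (H2π_eq_zero_iff (A := Rep.trivial ℤ (G0 T) ℤ) (FC hT x)).trans ?_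
  refine (mem_cob _).trans ?_
  constructor
  · rintro ⟨h, hh⟩
    exact coboundary_F hT _ _ _ h hh
  · obtain ⟨k, m, n⟩ := x
    rintro ⟨hk, l1, l2, hm, hn⟩
    simp only at hk hm hn
    subst hk hm hn
    exact ⟨_, fun a b => F_coboundary hT l1 l2 a b⟩

/-- Normal form of the matrix. -/
lemma arith (A B C : ℤ) (g : ℕ) (hg : g = Int.gcd B C) (h0 : A ^ 2 = -(B * C)) (hne : g ≠ 0) :
    ∃ e u v : ℤ, (e = 1 ∨ e = -1) ∧ IsCoprime u v ∧ B = g * e * u ^ 2 ∧ C = - g * e * v ^ 2 ∧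
      A = g * e * u * v := by
  obtain ⟨B', hB⟩ : (g : ℤ) ∣ B := hg ▸ Int.gcd_dvd_left ..
  obtain ⟨C', hC⟩ : (g : ℤ) ∣ C := hg ▸ Int.gcd_dvd_right ..
  have hgz : (g : ℤ) ≠ 0 := by exact_mod_cast hne
  obtain ⟨A', hA⟩ : (g : ℤ) ∣ A := by
    rw [← Int.pow_dvd_pow_iff (two_ne_zero)]
    exact ⟨-(B' * C'), by rw [h0, hB, hC]; ring⟩
  have hcop : IsCoprime B' C' := by
    have := Int.gcd_eq_gcd_ab B C
    refine ⟨Int.gcdA B C, Int.gcdB B C, ?_⟩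
    apply mul_left_cancel₀ hgz
    rw [← hg] at this
    linear_combination -this - Int.gcdA B C * hB - Int.gcdB B C * hC
  have h1 : A' ^ 2 = - (B' * C') := by
    apply mul_left_cancel₀ (pow_ne_zero 2 hgz)
    rw [hA, hB, hC] at h0
    linear_combination h0
  have hg1 : Int.gcd B' (-C') = 1 := by
    rw [← Int.isCoprime_iff_gcd_eq_one]; exact hcop.neg_right
  have hg2 : Int.gcd (-C') B' = 1 := by
    rw [← Int.isCoprime_iff_gcd_eq_one]; exact hcop.symm.neg_left
  obtain ⟨u, hu⟩ := Int.sq_of_gcd_eq_one hg1 (c := A') (by linarith)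
  obtain ⟨v, hv⟩ := Int.sq_of_gcd_eq_one hg2 (c := A') (by linarith)
  -- choose a common sign
  have hs : ∃ e : ℤ, (e = 1 ∨ e = -1) ∧ B' = e * u ^ 2 ∧ -C' = e * v ^ 2 := by
    rcases hu with hu | hu <;> rcases hv with hv | hv
    · exact ⟨1, by simp, by linarith, by linarith⟩
    · have : (u * v) ^ 2 + A' ^ 2 = 0 := by
        rw [h1, hu, ← neg_neg C', hv]; ring
      have h2 : u * v = 0 := by nlinarith
      rcases mul_eq_zero.1 h2 with h3 | h3
      · subst h3; exact ⟨-1, by simp, by rw [hu]; ring, by rw [hv]; ring⟩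
      · subst h3; exact ⟨1, by simp, by rw [hu]; ring, by rw [hv]; ring⟩
    · have : (u * v) ^ 2 + A' ^ 2 = 0 := by
        rw [h1, hu, ← neg_neg C', hv]; ring
      have h2 : u * v = 0 := by nlinarith
      rcases mul_eq_zero.1 h2 with h3 | h3
      · subst h3; exact ⟨1, by simp, by rw [hu]; ring, by rw [hv]; ring⟩
      · subst h3; exact ⟨-1, by simp, by rw [hu]; ring, by rw [hv]; ring⟩
    · exact ⟨-1, by simp, by linarith, by linarith⟩
  obtain ⟨e, he, hB', hC'⟩ := hs
  have hee : e ^ 2 = 1 := by rcases he with rfl | rfl <;> norm_num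
  have hA2 : A' ^ 2 = (e * u * v) ^ 2 := by
    rw [h1, hB', ← neg_neg C', hC']; ring
  have huv : IsCoprime u v := by
    have : IsCoprime (u * (e * u)) (v * (e * v)) := by
      have := hcop.neg_right
      have e1 : u * (e * u) = B' := by rw [hB']; ring
      have e2 : v * (e * v) = -C' := by rw [hC']; ring
      rw [e1, e2]
      exact this
    exact this.of_mul_left_left.of_mul_right_left
  rcases sq_eq_sq_iff_eq_or_eq_neg.1 hA2 with h | h
  · refine ⟨e, u, v, he, huv, ?_, ?_, ?_⟩
    · rw [hB, hB']; ring
    · rw [hC, ← neg_neg C', hC']; ring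
    · rw [hA, h]; ring
  · refine ⟨e, u, -v, he, huv.neg_right, ?_, ?_, ?_⟩
    · rw [hB, hB']; ring
    · rw [hC, ← neg_neg C', hC']; ring
    · rw [hA, h]; ring

theorem main (hT : Acts p T) (htr : p.α + p.δ = 2) (hne : Int.gcd p.β p.γ ≠ 0) :
    Nonempty (groupCohomology (Rep.trivial ℤ (G0 T) ℤ) 2 ≃+ ZMod (Int.gcd p.β p.γ) × ℤ × ℤ) := by
  obtain ⟨e, u, v, he, ⟨w1, w2, hw⟩, hB, hC, hA⟩ := arith (p.α - 1) p.β p.γ _ rfl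
    (by have := p.hdet
        have hd : p.δ = 2 - p.α := by linarith
        rw [hd] at this
        linear_combination -this) hne
  set g := Int.gcd p.β p.γ
  have hee : e * e = 1 := by rcases he with rfl | rfl <;> norm_num
  -- primitive vector (m, n) = (u, -v)
  let Φ : ℤ × ℤ × ℤ →+ ZMod g × ℤ × ℤ := AddMonoidHom.mk'
    (fun x => (((w1 * x.2.1 - w2 * x.2.2 : ℤ) : ZMod g), x.1, v * x.2.1 + u * x.2.2)) (by
      intro x y
      ext
      · simp; ring
      · simp
      · simp; ring)
  have hΦ : ∀ x, Φ x = (((w1 * x.2.1 - w2 * x.2.2 : ℤ) : ZMod g), x.1, v * x.2.1 + u * x.2.2) :=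
    fun _ => rfl
  have hsurj : Function.Surjective Φ := by
    rintro ⟨a, b, c⟩
    obtain ⟨a, rfl⟩ := ZMod.intCast_surjective a
    refine ⟨(b, a * u + w2 * c, - a * v + w1 * c), ?_⟩
    rw [hΦ]
    ext
    · simp only
      congr 1
      linear_combination a * hw
    · rfl
    · simp only
      linear_combination c * hw
  have hker : ∀ x, Φ x = 0 ↔ Psi hT x = 0 := by
    rintro ⟨k, m, n⟩
    rw [hΦ, Psi_ker, Prod.ext_iff, Prod.ext_iff]
    simp only [Prod.fst_zero, Prod.snd_zero]
    rw [ZMod.intCast_zmod_eq_zero_iff_dvd]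
    have hα : p.α = 1 + g * e * u * v := by linarith
    have hδ : p.δ = 1 - g * e * u * v := by linarith
    rw [hα, hδ, hB, hC]
    constructor
    · rintro ⟨⟨q, hq⟩, rfl, h3⟩
      refine ⟨rfl, -e * q * w2, -e * q * w1, ?_, ?_⟩
      · have : m = g * q * u := by
          linear_combination u * hq + w2 * h3 - m * hw
        rw [this]
        linear_combination (-g * q * u) * hw - g * q * u * (w1 * u + w2 * v) * (hee)
      · have : n = - g * q * v := by
          linear_combination -v * hq + w1 * h3 - n * hw
        rw [this]
        linear_combination (g * q * v) * hw + g * q * v * (w1 * u + w2 * v) * (hee)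
    · rintro ⟨rfl, l1, l2, hm, hn⟩
      refine ⟨⟨-e * (v * l1 + u * l2), ?_⟩, rfl, ?_⟩
      · rw [hm, hn]
        linear_combination (-g * e * (v * l1 + u * l2)) * hw
      · rw [hm, hn]; ring
  have hk : Φ.ker = (Psi hT).ker := by
    ext x
    exact hker x
  exact ⟨(QuotientAddGroup.quotientKerEquivOfSurjective _ (Psi_surj hT)).symm.trans
    ((QuotientAddGroup.quotientAddEquivOfEq hk.symm).trans
      (QuotientAddGroup.quotientKerEquivOfSurjective _ hsurj))⟩

end final

end TB

theorem torusBundle_H2_rank1_detOne (θ : GL (Fin 2) ℤ)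
    (hr : ((θ : Matrix (Fin 2) (Fin 2) ℤ) - 1).rank = 1)
    (hdet : (θ : Matrix (Fin 2) (Fin 2) ℤ).det = 1) :
    Nonempty ((groupCohomology (Rep.trivial ℤ (TorusBundleGroup θ) ℤ) 2) ≃+
      (ZMod (Int.gcd ((θ : Matrix (Fin 2) (Fin 2) ℤ) 1 0) ((θ : Matrix (Fin 2) (Fin 2) ℤ) 0 1)) × ℤ × ℤ)) := by
  have hd := hdet
  rw [Matrix.det_fin_two] at hd
  let p : TB.Par := ⟨θ.1 0 0, θ.1 1 0, θ.1 0 1, θ.1 1 1, by linarith⟩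
  have hT : TB.Acts p (torusAut θ) := by
    intro a b
    apply Multiplicative.toAdd.injective
    change (θ.1).mulVec ![a, b] = _
    funext i
    fin_cases i <;> simp [Matrix.mulVec, dotProduct, p]
  have hdet0 : (θ.1 - 1).det = 0 := by
    by_contra hne
    have hinj : Function.Injective (θ.1 - 1).mulVecLin := by
      have := Matrix.mulVec_injective_of_det_ne_zero hne
      exact this
    have := LinearMap.finrank_range_of_inj hinj
    rw [Matrix.rank, this] at hr
    simp at hr
  have htr : p.α + p.δ = 2 := by
    rw [Matrix.det_fin_two] at hdet0
    simp at hdet0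
    change θ.1 0 0 + θ.1 1 1 = 2
    linarith
  have hne : Int.gcd p.β p.γ ≠ 0 := by
    intro h
    rw [Int.gcd_eq_zero_iff] at h
    obtain ⟨h1, h2⟩ := h
    have h3 := p.hdet
    rw [h1, h2] at h3
    have h4 : p.δ = 2 - p.α := by linarith
    have h5 : p.α = 1 := by
      rw [h4] at h3
      nlinarith
    have h6 : p.δ = 1 := by linarith
    have : θ.1 - 1 = 0 := by
      ext i j
      fin_cases i <;> fin_cases j <;> simp [p] at * <;> linarith
    rw [this] at hr
    simp at hr
  exact TB.main hT htr hne
end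

section
/- If the integer matrix θ − I has rank 1 and det θ = −1, then H²(G, ℤ) ≅ ℤ/gcd(β,γ,2) ⊕ ℤ. -/
open Matrix

/-- The 2-cocycle identity for trivial integer coefficients. -/
def IsCoc {G : Type} [Group G] (f : G → G → ℤ) : Prop :=
  ∀ g h j : G, f (g * h) j + f g h = f h j + f g (h * j)

theorem IsCoc.one_left {G : Type} [Group G] {f : G → G → ℤ} (hf : IsCoc f) (g : G) :
    f 1 g = f 1 1 := by
  have := hf 1 1 g
  simp only [one_mul] at this
  linarith

theorem IsCoc.one_right {G : Type} [Group G] {f : G → G → ℤ} (hf : IsCoc f) (g : G) :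
    f g 1 = f 1 1 := by
  have := hf g 1 1
  simp only [mul_one] at this
  linarith

/-- The commutator pairing is additive. -/
theorem IsCoc.pair_add {G : Type} [Group G] {f : G → G → ℤ} (hf : IsCoc f) (u v w : G)
    (huw : u * w = w * u) (hvw : v * w = w * v) :
    f (u * v) w - f w (u * v) = (f u w - f w u) + (f v w - f w v) := by
  have h1 := hf u v w
  have h2 := hf w u v
  have h3 := hf u w v
  rw [hvw] at h1
  rw [huw] at h3
  linarith

/-- The commutator pairing is invariant under conjugation. -/
theorem IsCoc.pair_conj {G : Type} [Group G] {f : G → G → ℤ} (hf : IsCoc f) (t u w u' w' : G)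
    (huw : u * w = w * u) (huw' : u' * w' = w' * u') (hu : t * u = u' * t) (hw : t * w = w' * t) :
    f u' w' - f w' u' = f u w - f w u := by
  have h1 := hf t u w
  have h2 := hf t w u
  have h3 := hf u' t w
  have h4 := hf w' t u
  have h5 := hf u' w' t
  have h6 := hf w' u' t
  rw [hu, huw] at h1
  rw [hw] at h2 h3
  rw [hu] at h4
  rw [huw'] at h5
  linarith

/-- The central extension by the integers attached to a cocycle. -/
@[ext]
structure CExt {G : Type} [Group G] (f : G → G → ℤ) (hf : IsCoc f) where
  z : ℤ
  g : G

namespace CExt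

variable {G : Type} [Group G] {f : G → G → ℤ} {hf : IsCoc f}

instance : Mul (CExt f hf) := ⟨fun a b => ⟨a.z + b.z + f a.g b.g, a.g * b.g⟩⟩
instance : One (CExt f hf) := ⟨⟨- f 1 1, 1⟩⟩
instance : Inv (CExt f hf) := ⟨fun a => ⟨- a.z - f a.g⁻¹ a.g - f 1 1, a.g⁻¹⟩⟩

@[simp] theorem mul_z (a b : CExt f hf) : (a * b).z = a.z + b.z + f a.g b.g := rfl
@[simp] theorem mul_g (a b : CExt f hf) : (a * b).g = a.g * b.g := rfl
@[simp] theorem one_z : (1 : CExt f hf).z = - f 1 1 := rfl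
@[simp] theorem one_g : (1 : CExt f hf).g = 1 := rfl
@[simp] theorem inv_z (a : CExt f hf) : (a⁻¹).z = - a.z - f a.g⁻¹ a.g - f 1 1 := rfl
@[simp] theorem inv_g (a : CExt f hf) : (a⁻¹).g = a.g⁻¹ := rfl

instance : Group (CExt f hf) := Group.ofLeftAxioms
  (by
    intro a b c
    ext
    · have := hf a.g b.g c.g
      simp only [mul_z, mul_g]
      linarith
    · simp [mul_assoc])
  (by
    intro a
    ext
    · simp [hf.one_left a.g]
    · simp)
  (by
    intro a
    ext
    · simp only [mul_z, inv_z, inv_g, one_z]; ring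
    · simp)

/-- Projection to the base group. -/
def proj : CExt f hf →* G where
  toFun := CExt.g
  map_one' := rfl
  map_mul' _ _ := rfl

/-- The central copy of the integers. -/
def inj (n : ℤ) : CExt f hf := ⟨n - f 1 1, 1⟩

theorem inj_add (m n : ℤ) : (inj (m + n) : CExt f hf) = inj m * inj n := by
  ext
  · simp only [inj, mul_z]; ring
  · simp [inj]

theorem inj_inj {m n : ℤ} (h : (inj m : CExt f hf) = inj n) : m = n := by
  have := congrArg CExt.z h
  simpa [inj] using this

theorem inj_zero : (inj 0 : CExt f hf) = 1 := by
  ext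
  · simp [inj]
  · simp [inj]

theorem mul_inj_z (a : CExt f hf) (n : ℤ) : (a * inj n).z = a.z + n := by
  simp only [inj, mul_z, hf.one_right a.g]; ring

theorem inj_comm (a : CExt f hf) (n : ℤ) : inj n * a = a * inj n := by
  ext
  · simp only [inj, mul_z, hf.one_right a.g, hf.one_left a.g]; ring
  · simp [inj]

theorem exists_inj (a b : CExt f hf) (h : a.g = b.g) : ∃ n : ℤ, a = b * inj n := by
  refine ⟨a.z - b.z, ?_⟩
  ext
  · rw [mul_inj_z]; ring
  · simp [inj, h]

end CExt

/-- Group data of a semidirect product of `ℤ²` by `ℤ`. -/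
structure SD (G : Type) [Group G] (M : ℤ → Matrix (Fin 2) (Fin 2) ℤ) where
  vec : G → (Fin 2 → ℤ)
  ht : G → ℤ
  pt : (Fin 2 → ℤ) → ℤ → G
  vec_pt : ∀ v m, vec (pt v m) = v
  ht_pt : ∀ v m, ht (pt v m) = m
  ext' : ∀ g h, vec g = vec h → ht g = ht h → g = h
  vec_mul : ∀ g h, vec (g * h) = vec g + Matrix.mulVec (M (ht g)) (vec h)
  ht_mul : ∀ g h, ht (g * h) = ht g + ht h

/-- The pairing of a vector with linear functional. -/
theorem lin_eq_dot (φ : (Fin 2 → ℤ) →+ ℤ) (v : Fin 2 → ℤ) :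
    φ v = φ ![1, 0] * v 0 + φ ![0, 1] * v 1 := by
  have h : v = v 0 • ![1, 0] + v 1 • ![0, 1] := by
    ext i; fin_cases i <;> simp
  conv_lhs => rw [h]
  rw [map_add, map_zsmul, map_zsmul]
  simp [mul_comm]

theorem SD.symm_on {G : Type} [Group G] {M : ℤ → Matrix (Fin 2) (Fin 2) ℤ} (D : SD G M)
    (hM0 : M 0 = 1) (hdet : (M 1).det = -1)
    {f : G → G → ℤ} (hf : IsCoc f) (v w : Fin 2 → ℤ) :
    f (D.pt v 0) (D.pt w 0) = f (D.pt w 0) (D.pt v 0) := by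
  have hmul : ∀ v w, D.pt v 0 * D.pt w 0 = D.pt (v + w) 0 := by
    intro v w
    apply D.ext'
    · simp [D.vec_mul, D.vec_pt, D.ht_pt, hM0]
    · simp [D.ht_mul, D.ht_pt]
  have hc : ∀ v w, D.pt v 0 * D.pt w 0 = D.pt w 0 * D.pt v 0 := by
    intro v w; rw [hmul, hmul, add_comm]
  let B : (Fin 2 → ℤ) → (Fin 2 → ℤ) → ℤ := fun v w =>
    f (D.pt v 0) (D.pt w 0) - f (D.pt w 0) (D.pt v 0)
  have hBl : ∀ u v w, B (u + v) w = B u w + B v w := by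
    intro u v w
    have := hf.pair_add (D.pt u 0) (D.pt v 0) (D.pt w 0) (hc _ _) (hc _ _)
    rw [hmul] at this
    exact this
  have hBs : ∀ v w, B v w = - B w v := by intro v w; simp only [B]; ring
  have hBr : ∀ u v w, B w (u + v) = B w u + B w v := by
    intro u v w
    rw [hBs, hBl, hBs u, hBs v]; ring
  have hB0 : ∀ v, B v v = 0 := by intro v; simp only [B]; ring
  have key : ∀ v w, B v w = B ![1, 0] ![0, 1] * (v 0 * w 1 - v 1 * w 0) := by
    intro v w
    have h1 := lin_eq_dot (AddMonoidHom.mk' (fun v => B v w) (fun a b => hBl a b w)) v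
    have h2 := fun u => lin_eq_dot (AddMonoidHom.mk' (fun w => B u w) (fun a b => hBr a b u)) w
    simp only [AddMonoidHom.mk'_apply] at h1 h2
    rw [h1, h2 ![1, 0], h2 ![0, 1], hB0, hB0, hBs ![0, 1] ![1, 0]]
    ring
  have hinv : B (M 1 *ᵥ ![1, 0]) (M 1 *ᵥ ![0, 1]) = B ![1, 0] ![0, 1] := by
    have ht : ∀ v, D.pt 0 1 * D.pt v 0 = D.pt (M 1 *ᵥ v) 0 * D.pt 0 1 := by
      intro v
      apply D.ext'
      · simp [D.vec_mul, D.vec_pt, D.ht_pt]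
      · simp [D.ht_mul, D.ht_pt]
    exact hf.pair_conj (D.pt 0 1) _ _ _ _ (hc _ _) (hc _ _) (ht _) (ht _)
  rw [key] at hinv
  rw [Matrix.det_fin_two] at hdet
  have : B v w = 0 := by
    rw [key]
    have : B ![1, 0] ![0, 1] = 0 := by
      simp [Matrix.mulVec, dotProduct, Fin.sum_univ_two] at hinv
      have h2 : M 1 0 0 * M 1 1 1 - M 1 1 0 * M 1 0 1 = -1 := by linarith
      rw [h2] at hinv
      linarith
    rw [this, zero_mul]
  simp only [B] at this
  linarith

theorem SD.exists_normal {G : Type} [Group G] {M S : ℤ → Matrix (Fin 2) (Fin 2) ℤ} (D : SD G M)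
    (hM0 : M 0 = 1) (hdet : (M 1).det = -1) (hMadd : ∀ m n, M (m + n) = M m * M n)
    (hS1 : S 1 = 1) (hSadd : ∀ m n, S (m + n) = S m * M n + S n)
    {f : G → G → ℤ} (hf : IsCoc f) :
    ∃ x : Fin 2 → ℤ, ∃ h : G → ℤ, ∀ g k : G,
      x ⬝ᵥ (S (D.ht g) *ᵥ D.vec k) - f g k = h k - h (g * k) + h g := by
  have hpt1 : D.pt 0 0 = 1 := by
    have : D.pt 0 0 * D.pt 0 0 = D.pt 0 0 := by
      apply D.ext'
      · simp [D.vec_mul, D.vec_pt, D.ht_pt]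
      · simp [D.ht_mul, D.ht_pt]
    simpa using this
  let e1 : CExt f hf := ⟨0, D.pt ![1, 0] 0⟩
  let e2 : CExt f hf := ⟨0, D.pt ![0, 1] 0⟩
  let t : CExt f hf := ⟨0, D.pt 0 1⟩
  have hcomm : Commute e1 e2 := by
    change e1 * e2 = e2 * e1
    ext
    · simp [e1, e2, D.symm_on hM0 hdet hf ![1, 0] ![0, 1]]
    · apply D.ext'
      · simp [e1, e2, D.vec_mul, D.vec_pt, D.ht_pt, hM0]
      · simp [e1, e2, D.ht_mul, D.ht_pt]
  let ψ : (Fin 2 → ℤ) → CExt f hf := fun v => e1 ^ v 0 * e2 ^ v 1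
  have hψ : ∀ v w, ψ (v + w) = ψ v * ψ w := by
    intro v w
    simp only [ψ, Pi.add_apply, _root_.zpow_add]
    have := (hcomm.zpow_zpow (w 0) (v 1)).eq
    rw [mul_assoc, mul_assoc, ← mul_assoc (e2 ^ v 1) (e1 ^ w 0), ← this]
    simp only [mul_assoc]
  -- coordinates of elements
  let ptHom : Multiplicative (Fin 2 → ℤ) →* G :=
    { toFun := fun v => D.pt v.toAdd 0
      map_one' := hpt1
      map_mul' := by
        intro v w
        apply D.ext'
        · simp [D.vec_mul, D.vec_pt, D.ht_pt, hM0]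
        · simp [D.ht_mul, D.ht_pt] }
  have hptz : ∀ (v : Fin 2 → ℤ) (n : ℤ), D.pt v 0 ^ n = D.pt (n • v) 0 := by
    intro v n
    have := map_zpow ptHom (Multiplicative.ofAdd v) n
    exact this.symm
  have hpz : ∀ (a : CExt f hf) (n : ℤ), (a ^ n).g = a.g ^ n := fun a n => map_zpow CExt.proj a n
  have hψg : ∀ v, (ψ v).g = D.pt v 0 := by
    intro v
    simp only [ψ, CExt.mul_g, hpz, e1, e2, hptz]
    apply D.ext'
    · simp only [D.vec_mul, D.vec_pt, D.ht_pt, hM0, one_mulVec]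
      ext i; fin_cases i <;> simp
    · simp [D.ht_mul, D.ht_pt]
  have htg : ∀ m : ℤ, (t ^ m).g = D.pt 0 m := by
    let htHom : Multiplicative ℤ →* G :=
      { toFun := fun m => D.pt 0 m.toAdd
        map_one' := hpt1
        map_mul' := by
          intro v w
          apply D.ext'
          · simp [D.vec_mul, D.vec_pt, D.ht_pt]
          · simp [D.ht_mul, D.ht_pt] }
    intro m
    have := map_zpow htHom (Multiplicative.ofAdd 1) m
    rw [hpz]
    simp only [← ofAdd_zsmul] at this
    simpa [htHom, t] using this.symm
  have hex : ∀ v, ∃ n : ℤ, t * ψ v = ψ (M 1 *ᵥ v) * t * CExt.inj n := by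
    intro v
    apply CExt.exists_inj
    simp only [CExt.mul_g, hψg, t]
    apply D.ext'
    · simp [D.vec_mul, D.vec_pt, D.ht_pt, hM0]
    · simp [D.ht_mul, D.ht_pt]
  choose φ hφ using hex
  have hφadd : ∀ v w, φ (v + w) = φ v + φ w := by
    intro v w
    apply CExt.inj_inj (hf := hf)
    have h1 := hφ (v + w)
    rw [hψ, ← mul_assoc, hφ v, mul_assoc, CExt.inj_comm, ← mul_assoc, mul_assoc (ψ _) t, hφ w,
      mulVec_add, hψ] at h1
    simp only [mul_assoc] at h1
    rw [← CExt.inj_add] at h1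
    have := mul_left_cancel (mul_left_cancel (mul_left_cancel h1))
    rw [← this, add_comm]
  let φ' : (Fin 2 → ℤ) →+ ℤ := AddMonoidHom.mk' φ hφadd
  have hS0 : S 0 = 0 := by
    have := hSadd 0 0
    simpa [hM0] using this
  have hM1 : M 1 * M (-1) = 1 := by rw [← hMadd]; simpa using hM0
  have hSm1 : S (-1) = - M (-1) := by
    have := hSadd 1 (-1)
    rw [hS1] at this
    simp only [add_neg_cancel, hS0, one_mul] at this
    exact (neg_eq_of_add_eq_zero_right this.symm).symm
  let P : ℤ → Prop := fun m => ∀ v, t ^ m * ψ v =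
    ψ (M m *ᵥ v) * t ^ m * CExt.inj (φ' (S m *ᵥ v))
  have hPadd : ∀ m n, P m → P n → P (m + n) := by
    intro m n hm hn v
    rw [_root_.zpow_add, mul_assoc, hn, ← mul_assoc, ← mul_assoc, hm, hMadd, ← mulVec_mulVec,
      hSadd, add_mulVec, map_add, CExt.inj_add, ← mulVec_mulVec]
    simp only [mul_assoc]
    rw [← mul_assoc (CExt.inj _) (t ^ n), CExt.inj_comm]
    simp only [mul_assoc]
  have hP1 : P 1 := by
    intro v
    simp only [zpow_one, hS1, one_mulVec]
    exact hφ v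
  have hP0 : P 0 := by
    intro v
    simp [hM0, hS0, CExt.inj_zero]
  have hPm1 : P (-1) := by
    intro w
    have h := hP1 (M (-1) *ᵥ w)
    rw [mulVec_mulVec, hM1, hS1, one_mulVec, one_mulVec, zpow_one] at h
    rw [hSm1, neg_mulVec, map_neg, _root_.zpow_neg_one, inv_mul_eq_iff_eq_mul, mul_assoc, ← mul_assoc t, h]
    simp only [mul_assoc]
    rw [← mul_assoc (CExt.inj _), CExt.inj_comm]
    simp only [mul_assoc]
    rw [← CExt.inj_add]
    simp [CExt.inj_zero]
  have hP : ∀ m, P m := by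
    intro m
    induction m using Int.induction_on with
    | zero => exact hP0
    | succ i ih => exact hPadd _ _ ih hP1
    | pred i ih => exact hPadd _ _ ih hPm1
  let s : G → CExt f hf := fun g => ψ (D.vec g) * t ^ D.ht g
  have hsg : ∀ g, (s g).g = g := by
    intro g
    simp only [s, CExt.mul_g, hψg, htg]
    apply D.ext'
    · simp [D.vec_mul, D.vec_pt, D.ht_pt]
    · simp [D.ht_mul, D.ht_pt]
  have hss : ∀ g k, s g * s k = s (g * k) * CExt.inj (φ' (S (D.ht g) *ᵥ D.vec k)) := by
    intro g k
    simp only [s, D.vec_mul, D.ht_mul]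
    have := hP (D.ht g) (D.vec k)
    rw [mul_assoc, ← mul_assoc (t ^ _), this, hψ, _root_.zpow_add]
    simp only [mul_assoc]
    rw [CExt.inj_comm]
  refine ⟨![φ' ![1, 0], φ' ![0, 1]], fun g => (s g).z, ?_⟩
  intro g k
  have h := congrArg CExt.z (hss g k)
  rw [CExt.mul_inj_z, CExt.mul_z, hsg, hsg, lin_eq_dot φ'] at h
  simp only [dotProduct, Fin.sum_univ_two, cons_val_zero, cons_val_one]
  linarith

theorem exists_prim (a b c d : ℤ) (hdet : a * d = b * c) (htr : a + d = -2) :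
    ∃ p q u v h k : ℤ, u * p + v * q = 1 ∧ a = h * p ∧ c = h * q ∧ b = k * p ∧ d = k * q := by
  have main : ∀ a b c d : ℤ, a * d = b * c → (a ≠ 0 ∨ c ≠ 0) →
      ∃ p q u v h k : ℤ, u * p + v * q = 1 ∧ a = h * p ∧ c = h * q ∧ b = k * p ∧ d = k * q := by
    intro a b c d hdet hne
    have hg : 0 < Int.gcd a c := by
      rcases hne with h | h
      · exact Int.gcd_pos_of_ne_zero_left _ h
      · exact Int.gcd_pos_of_ne_zero_right _ h
    obtain ⟨p, hp⟩ := Int.gcd_dvd_left a c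
    obtain ⟨q, hq⟩ := Int.gcd_dvd_right a c
    have hbez := Int.gcd_eq_gcd_ab a c
    set h : ℤ := (Int.gcd a c : ℤ) with hh
    have hpos : h ≠ 0 := by rw [hh]; exact_mod_cast hg.ne'
    set u := Int.gcdA a c
    set v := Int.gcdB a c
    have huv : u * p + v * q = 1 := by
      apply mul_left_cancel₀ hpos
      rw [mul_one]
      conv_rhs => rw [hbez]
      linear_combination (-u) * hp - v * hq
    have hpd : p * d = b * q := by
      apply mul_left_cancel₀ hpos
      linear_combination hdet - d * hp + b * hq
    refine ⟨p, q, u, v, h, b * u + d * v, huv, hp, hq, ?_, ?_⟩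
    · linear_combination (-b) * huv - v * hpd
    · linear_combination (-d) * huv + u * hpd
  by_cases hne : a ≠ 0 ∨ c ≠ 0
  · exact main a b c d hdet hne
  · push Not at hne
    obtain ⟨p, q, u, v, h, k, h1, h2, h3, h4, h5⟩ := main b a d c (by linarith) (Or.inr (by
      intro hd; rw [hd, hne.1] at htr; norm_num at htr))
    exact ⟨p, q, u, v, k, h, h1, h4, h5, h2, h3⟩

theorem exists_coker (a b c d : ℤ) (hdet : a * d = b * c) (htr : a + d = -2) :
    ∃ P : (Fin 2 → ℤ) →+ ZMod (Nat.gcd (Int.gcd b c) 2) × ℤ, Function.Surjective P ∧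
      ∀ x, P x = 0 ↔ ∃ y : Fin 2 → ℤ, x = ![y 0 * a + y 1 * b, y 0 * c + y 1 * d] := by
  obtain ⟨p, q, u, v, h, k, huv, ha, hc, hb, hd⟩ := exists_prim a b c d hdet htr
  have hg : (Nat.gcd (Int.gcd b c) 2 : ℕ) = Int.gcd h k := by
    apply Nat.dvd_antisymm
    · have h2 : ((Nat.gcd (Int.gcd b c) 2 : ℕ) : ℤ) ∣ 2 := by
        exact_mod_cast Nat.gcd_dvd_right _ _
      have hb' : ((Nat.gcd (Int.gcd b c) 2 : ℕ) : ℤ) ∣ b :=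
        (Int.natCast_dvd_natCast.2 (Nat.gcd_dvd_left _ _)).trans (Int.gcd_dvd_left _ _)
      have hc' : ((Nat.gcd (Int.gcd b c) 2 : ℕ) : ℤ) ∣ c :=
        (Int.natCast_dvd_natCast.2 (Nat.gcd_dvd_left _ _)).trans (Int.gcd_dvd_right _ _)
      have ha' : ((Nat.gcd (Int.gcd b c) 2 : ℕ) : ℤ) ∣ a := by
        have hle : Nat.gcd (Int.gcd b c) 2 ∣ 2 := Nat.gcd_dvd_right _ _
        rcases (Nat.dvd_prime Nat.prime_two).1 hle with h1 | h1
        · rw [h1]; simp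
        · rw [h1] at hb' ⊢
          have : (2 : ℤ) ∣ a ^ 2 := by
            have e : a ^ 2 = 2 * (-a) - b * c := by
              have : d = -2 - a := by linarith
              rw [this] at hdet
              linarith
            rw [e]
            exact (Dvd.intro _ rfl).sub (hb'.mul_right c)
          exact Int.prime_two.dvd_of_dvd_pow this
      have hd' : ((Nat.gcd (Int.gcd b c) 2 : ℕ) : ℤ) ∣ d := by
        have : d = -2 - a := by linarith
        rw [this]; exact (h2.neg_right).sub ha'
      rw [← Int.natCast_dvd_natCast]
      apply Int.dvd_coe_gcd
      · have : h = u * a + v * c := by rw [ha, hc]; linear_combination (-h) * huv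
        rw [this]; exact (ha'.mul_left _).add (hc'.mul_left _)
      · have : k = u * b + v * d := by rw [hb, hd]; linear_combination (-k) * huv
        rw [this]; exact (hb'.mul_left _).add (hd'.mul_left _)
    · have hh := Int.gcd_dvd_left h k
      have hk := Int.gcd_dvd_right h k
      apply Nat.dvd_gcd
      · rw [← Int.natCast_dvd_natCast]
        apply Int.dvd_coe_gcd
        · rw [hb]; exact hk.mul_right _
        · rw [hc]; exact hh.mul_right _
      · rw [← Int.natCast_dvd_natCast]
        have : ((2 : ℕ) : ℤ) = -(h * p + k * q) := by push_cast; linarith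
        rw [this]
        exact ((hh.mul_right _).add (hk.mul_right _)).neg_right
  rw [hg]
  refine ⟨AddMonoidHom.mk' (fun x => (((u * x 0 + v * x 1 : ℤ) : ZMod _), p * x 1 - q * x 0)) ?_,
    ?_, ?_⟩
  · intro x y
    ext
    · simp; ring
    · simp; ring
  · rintro ⟨m, n⟩
    obtain ⟨m, rfl⟩ := ZMod.intCast_surjective m
    refine ⟨![m * p - n * v, m * q + n * u], ?_⟩
    simp only [AddMonoidHom.mk'_apply, cons_val_zero, cons_val_one]
    refine Prod.ext ?_ ?_
    · have e : u * (m * p - n * v) + v * (m * q + n * u) = m := by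
        linear_combination m * huv
      simp only [e]
    · change _ = n
      linear_combination n * huv
  · intro x
    simp only [AddMonoidHom.mk'_apply, Prod.mk_eq_zero, ZMod.intCast_zmod_eq_zero_iff_dvd]
    constructor
    · rintro ⟨⟨n, hn⟩, h2⟩
      have hbez := Int.gcd_eq_gcd_ab h k
      rw [hbez] at hn
      refine ⟨![n * Int.gcdA h k, n * Int.gcdB h k], ?_⟩
      ext i
      fin_cases i
      · simp only [Fin.zero_eta, cons_val_zero, cons_val_one]
        rw [ha, hb]
        linear_combination (-x 0) * huv + p * hn - v * h2
      · simp only [Fin.mk_one, cons_val_zero, cons_val_one]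
        rw [hc, hd]
        linear_combination (-x 1) * huv + q * hn + u * h2
    · rintro ⟨y, rfl⟩
      simp only [cons_val_zero, cons_val_one]
      rw [ha, hb, hc, hd]
      constructor
      · have : u * (y 0 * (h * p) + y 1 * (k * p)) + v * (y 0 * (h * q) + y 1 * (k * q))
          = h * y 0 + k * y 1 := by linear_combination (h * y 0 + k * y 1) * huv
        rw [this]
        exact ((Int.gcd_dvd_left h k).mul_right _).add ((Int.gcd_dvd_right h k).mul_right _)
      · ring

/-- The torus automorphisms form a homomorphism from `GL(2, ℤ)`. -/
theorem torusAut_apply_s4 (θ : GL (Fin 2) ℤ) (v : Multiplicative (Fin 2 → ℤ)) :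
    (torusAut θ v).toAdd = (θ : Matrix (Fin 2) (Fin 2) ℤ) *ᵥ v.toAdd := by
  simp [torusAut]

theorem torusAut_mul (θ η : GL (Fin 2) ℤ) : torusAut (θ * η) = torusAut θ * torusAut η := by
  ext v : 1
  apply Multiplicative.toAdd.injective
  rw [MulAut.mul_apply, torusAut_apply_s4, torusAut_apply_s4, torusAut_apply_s4]
  rw [mulVec_mulVec, Units.val_mul]

theorem torusAction_apply (θ : GL (Fin 2) ℤ) (m : Multiplicative ℤ)
    (v : Multiplicative (Fin 2 → ℤ)) :
    (torusAction θ m v).toAdd =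
      ((θ ^ m.toAdd : GL (Fin 2) ℤ) : Matrix (Fin 2) (Fin 2) ℤ) *ᵥ v.toAdd := by
  have h := map_zpow (MonoidHom.mk' torusAut torusAut_mul) θ m.toAdd
  simp only [MonoidHom.mk'_apply] at h
  rw [← torusAut_apply_s4, h]
  rfl

/-- The semidirect product data for the torus bundle group. -/
noncomputable def torusSD (θ : GL (Fin 2) ℤ) :
    SD (TorusBundleGroup θ)
      (fun m => ((θ ^ m : GL (Fin 2) ℤ) : Matrix (Fin 2) (Fin 2) ℤ)) where
  vec g := (SemidirectProduct.left g).toAdd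
  ht g := (SemidirectProduct.right g).toAdd
  pt v m := SemidirectProduct.mk (Multiplicative.ofAdd v) (Multiplicative.ofAdd m)
  vec_pt _ _ := rfl
  ht_pt _ _ := rfl
  ext' _ _ h1 h2 := SemidirectProduct.ext h1 h2
  vec_mul g h := congrArg (fun w => (SemidirectProduct.left g).toAdd + w)
    (torusAction_apply θ (SemidirectProduct.right g) (SemidirectProduct.left h))
  ht_mul _ _ := rfl

theorem exists_S (θ : GL (Fin 2) ℤ) (h2 : θ * θ = 1) :
    ∃ S : ℤ → Matrix (Fin 2) (Fin 2) ℤ, S 1 = 1 ∧ ∀ m n, S (m + n) =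
      S m * ((θ ^ n : GL (Fin 2) ℤ) : Matrix (Fin 2) (Fin 2) ℤ) + S n := by
  have hT : (θ : Matrix (Fin 2) (Fin 2) ℤ) * (θ : Matrix (Fin 2) (Fin 2) ℤ) = 1 := by
    rw [← Units.val_mul, h2]; rfl
  have hz : ∀ j : ℤ, θ ^ (2 * j) = 1 := by
    intro j
    rw [_root_.zpow_mul]
    have : θ ^ (2 : ℤ) = 1 := by rw [zpow_two]; exact h2
    rw [this, _root_.one_zpow]
  have hz1 : ∀ j : ℤ, θ ^ (2 * j + 1) = θ := by
    intro j
    rw [_root_.zpow_add, hz, _root_.zpow_one, one_mul]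
  refine ⟨fun m => (m / 2) • (1 + (θ : Matrix (Fin 2) (Fin 2) ℤ)) + (m % 2) • 1, by norm_num, ?_⟩
  intro m n
  rcases Int.even_or_odd' m with ⟨j, rfl | rfl⟩ <;> rcases Int.even_or_odd' n with ⟨k, rfl | rfl⟩
  · have e1 : (2 * j + 2 * k) / 2 = j + k := by omega
    have e2 : (2 * j + 2 * k) % 2 = 0 := by omega
    have e3 : (2 * j) / 2 = j := by omega
    have e4 : (2 * k) / 2 = k := by omega
    have e5 : (2 * j) % 2 = 0 := by omega
    have e6 : (2 * k) % 2 = 0 := by omega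
    simp only [e1, e2, e3, e4, e5, e6, hz, Units.val_one, mul_one]
    module
  · have e1 : (2 * j + (2 * k + 1)) / 2 = j + k := by omega
    have e2 : (2 * j + (2 * k + 1)) % 2 = 1 := by omega
    have e3 : (2 * j) / 2 = j := by omega
    have e4 : (2 * k + 1) / 2 = k := by omega
    have e5 : (2 * j) % 2 = 0 := by omega
    have e6 : (2 * k + 1) % 2 = 1 := by omega
    simp only [e1, e2, e3, e4, e5, e6, hz1, add_mul, smul_mul_assoc, one_mul, hT]
    module
  · have e1 : (2 * j + 1 + 2 * k) / 2 = j + k := by omega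
    have e2 : (2 * j + 1 + 2 * k) % 2 = 1 := by omega
    have e3 : (2 * j + 1) / 2 = j := by omega
    have e4 : (2 * k) / 2 = k := by omega
    have e5 : (2 * j + 1) % 2 = 1 := by omega
    have e6 : (2 * k) % 2 = 0 := by omega
    simp only [e1, e2, e3, e4, e5, e6, hz, Units.val_one, mul_one]
    module
  · have e1 : (2 * j + 1 + (2 * k + 1)) / 2 = j + k + 1 := by omega
    have e2 : (2 * j + 1 + (2 * k + 1)) % 2 = 0 := by omega
    have e3 : (2 * j + 1) / 2 = j := by omega
    have e4 : (2 * k + 1) / 2 = k := by omega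
    have e5 : (2 * j + 1) % 2 = 1 := by omega
    have e6 : (2 * k + 1) % 2 = 1 := by omega
    simp only [e1, e2, e3, e4, e5, e6, hz1, add_mul, smul_mul_assoc, one_mul, hT]
    module

theorem det_zero_of_rank (A : Matrix (Fin 2) (Fin 2) ℤ) (hr : A.rank = 1) : A.det = 0 := by
  by_contra hne
  have hinj : Function.Injective A.mulVecLin := by
    rw [← LinearMap.ker_eq_bot, LinearMap.ker_eq_bot']
    intro v hv
    exact Matrix.eq_zero_of_mulVec_eq_zero hne hv
  have := LinearMap.finrank_range_of_inj hinj
  rw [Matrix.rank, this] at hr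
  simp at hr

/-- If `θ - I` has rank `1` and `det θ = -1`, then
`H²(G, ℤ) ≅ ℤ/gcd(β, γ, 2) ⊕ ℤ`. -/
theorem torusBundle_H2_rank1_detNegOne (θ : GL (Fin 2) ℤ)
    (hr : ((θ : Matrix (Fin 2) (Fin 2) ℤ) - 1).rank = 1)
    (hdet : (θ : Matrix (Fin 2) (Fin 2) ℤ).det = -1) :
    Nonempty ((groupCohomology (Rep.trivial ℤ (TorusBundleGroup θ) ℤ) 2) ≃+
      (ZMod (Nat.gcd (Int.gcd ((θ : Matrix (Fin 2) (Fin 2) ℤ) 1 0) ((θ : Matrix (Fin 2) (Fin 2) ℤ) 0 1)) 2) × ℤ)) := by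
  have hd0 := det_zero_of_rank _ hr
  have hdet' := hdet
  rw [det_fin_two] at hdet' hd0
  simp only [Matrix.sub_apply, Matrix.one_apply, Fin.isValue, if_true, zero_ne_one, one_ne_zero, if_false,
    sub_zero] at hd0
  have htr : (θ : Matrix (Fin 2) (Fin 2) ℤ) 0 0 + (θ : Matrix (Fin 2) (Fin 2) ℤ) 1 1 = 0 := by
    linarith
  have h2 : θ * θ = 1 := by
    apply Units.ext
    rw [Units.val_mul, Units.val_one]
    have hd : (θ : Matrix (Fin 2) (Fin 2) ℤ) 1 1 = - (θ : Matrix (Fin 2) (Fin 2) ℤ) 0 0 := by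
      linarith
    rw [hd] at hdet'
    ext i j
    fin_cases i <;> fin_cases j <;> simp [mul_apply, Fin.sum_univ_two, hd] <;> linarith
  obtain ⟨S, hS1, hSadd⟩ := exists_S θ h2
  obtain ⟨P, hPs, hPk⟩ := exists_coker ((θ : Matrix (Fin 2) (Fin 2) ℤ) 0 0 - 1)
    ((θ : Matrix (Fin 2) (Fin 2) ℤ) 1 0) ((θ : Matrix (Fin 2) (Fin 2) ℤ) 0 1)
    ((θ : Matrix (Fin 2) (Fin 2) ℤ) 1 1 - 1) (by linarith) (by linarith)
  let D := torusSD θ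
  let A := Rep.trivial ℤ (TorusBundleGroup θ) ℤ
  let c : (Fin 2 → ℤ) → TorusBundleGroup θ × TorusBundleGroup θ → ℤ := fun x gk =>
    x ⬝ᵥ (S (D.ht gk.1) *ᵥ D.vec gk.2)
  have hc : ∀ x, c x ∈ groupCohomology.cocycles₂ A := by
    intro x
    rw [groupCohomology.mem_cocycles₂_iff (A := A)]
    intro g h j
    change c x (g * h, j) + c x (g, h) = c x (h, j) + c x (g, h * j)
    simp only [c, D.ht_mul, D.vec_mul, hSadd, add_mulVec, mulVec_add, mulVec_mulVec,
      dotProduct_add]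
    ring
  let Ψ : (Fin 2 → ℤ) →+ groupCohomology A 2 := AddMonoidHom.mk'
    (fun x => groupCohomology.H2π A ⟨c x, hc x⟩) (by
      intro x y
      rw [← map_add]
      congr 1
      apply Subtype.ext
      funext gk
      exact add_dotProduct x y (S (D.ht gk.1) *ᵥ D.vec gk.2))
  have hΨs : Function.Surjective Ψ := by
    intro y
    induction y using groupCohomology.H2_induction_on with
    | h f =>
      have hf : IsCoc (fun g h => (f (g, h) : ℤ)) := by
        intro g h j
        exact (groupCohomology.mem_cocycles₂_iff (A := A) f).1 f.2 g h j
      obtain ⟨x, h, hx⟩ := D.exists_normal (S := S) (by simp) (by simpa using hdet)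
        (by intro m n; rw [_root_.zpow_add, Units.val_mul]) hS1 hSadd hf
      refine ⟨x, ?_⟩
      change groupCohomology.H2π A ⟨c x, hc x⟩ = _
      rw [groupCohomology.H2π_eq_iff]
      refine ⟨h, ?_⟩
      funext gk
      exact (hx gk.1 gk.2).symm
  have hΨk : ∀ x, Ψ x = 0 ↔ ∃ y : Fin 2 → ℤ, x = ![y 0 * ((θ : Matrix (Fin 2) (Fin 2) ℤ) 0 0 - 1)
      + y 1 * (θ : Matrix (Fin 2) (Fin 2) ℤ) 1 0, y 0 * (θ : Matrix (Fin 2) (Fin 2) ℤ) 0 1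
      + y 1 * ((θ : Matrix (Fin 2) (Fin 2) ℤ) 1 1 - 1)] := by
    intro x
    change groupCohomology.H2π A ⟨c x, hc x⟩ = 0 ↔ _
    rw [groupCohomology.H2π_eq_zero_iff]
    have hS0 : S 0 = 0 := by
      have := hSadd 0 0
      simpa using this
    constructor
    · rintro ⟨h, hh⟩
      have hh' : ∀ g k, (h k : ℤ) - h (g * k) + h g = x ⬝ᵥ (S (D.ht g) *ᵥ D.vec k) :=
        fun g k => congrFun hh (g, k)
      have hadd : ∀ v w, (h (D.pt (v + w) 0) : ℤ) = h (D.pt v 0) + h (D.pt w 0) := by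
        intro v w
        have e : D.pt (v + w) 0 = D.pt v 0 * D.pt w 0 := by
          apply D.ext'
          · simp [D.vec_mul, D.vec_pt, D.ht_pt]
          · simp [D.ht_mul, D.ht_pt]
        have := hh' (D.pt v 0) (D.pt w 0)
        rw [D.ht_pt, hS0, zero_mulVec, dotProduct_zero, ← e] at this
        linarith
      let χ : (Fin 2 → ℤ) →+ ℤ := AddMonoidHom.mk' (fun v => (h (D.pt v 0) : ℤ)) hadd
      have hχ : ∀ v, x ⬝ᵥ v = χ v - χ ((θ : Matrix (Fin 2) (Fin 2) ℤ) *ᵥ v) := by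
        intro v
        have e : D.pt 0 1 * D.pt v 0 = D.pt ((θ : Matrix (Fin 2) (Fin 2) ℤ) *ᵥ v) 0 * D.pt 0 1 := by
          apply D.ext'
          · simp [D.vec_mul, D.vec_pt, D.ht_pt]
          · simp [D.ht_mul, D.ht_pt]
        have h1 := hh' (D.pt 0 1) (D.pt v 0)
        have h2 := hh' (D.pt ((θ : Matrix (Fin 2) (Fin 2) ℤ) *ᵥ v) 0) (D.pt 0 1)
        rw [D.ht_pt, D.vec_pt, hS1, one_mulVec, e] at h1
        rw [D.ht_pt, hS0, zero_mulVec, dotProduct_zero] at h2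
        simp only [χ, AddMonoidHom.mk'_apply]
        linarith
      refine ⟨![- χ ![1, 0], - χ ![0, 1]], ?_⟩
      have h1 := hχ ![1, 0]
      have h2 := hχ ![0, 1]
      rw [lin_eq_dot χ (_ *ᵥ _)] at h1 h2
      simp only [mulVec, dotProduct, Fin.sum_univ_two, cons_val_zero, cons_val_one] at h1 h2
      ext i
      fin_cases i
      · simp only [Fin.zero_eta, cons_val_zero, cons_val_one]
        linarith
      · simp only [Fin.mk_one, cons_val_zero, cons_val_one]
        linarith
    · rintro ⟨y, hy⟩
      have hx : x = y ᵥ* ((θ : Matrix (Fin 2) (Fin 2) ℤ) - 1) := by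
        rw [hy]
        ext i
        fin_cases i <;> simp [vecMul, dotProduct, Fin.sum_univ_two]
      have hSM : ∀ m : ℤ, ((θ : Matrix (Fin 2) (Fin 2) ℤ) - 1) * S m =
          ((θ ^ m : GL (Fin 2) ℤ) : Matrix (Fin 2) (Fin 2) ℤ) - 1 := by
        intro m
        induction m using Int.induction_on with
        | zero => simp [hS0]
        | succ i ih =>
          rw [hSadd, mul_add, ← mul_assoc, ih, hS1, _root_.zpow_add, Units.val_mul]
          simp [sub_mul]
        | pred i ih =>
          have e := hSadd (-(i : ℤ) - 1) 1
          rw [sub_add_cancel, hS1, _root_.zpow_one] at e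
          rw [e, mul_add, ← mul_assoc] at ih
          have hT : (θ : Matrix (Fin 2) (Fin 2) ℤ) * (θ : Matrix (Fin 2) (Fin 2) ℤ) = 1 := by
            rw [← Units.val_mul, h2]; rfl
          have e2 : ((θ ^ (-(i : ℤ)) : GL (Fin 2) ℤ) : Matrix (Fin 2) (Fin 2) ℤ) =
            ((θ ^ (-(i : ℤ) - 1) : GL (Fin 2) ℤ) : Matrix (Fin 2) (Fin 2) ℤ) * θ := by
            rw [← Units.val_mul, ← _root_.zpow_add_one, sub_add_cancel]
          rw [e2] at ih
          have ih2 := congrArg (fun X => X * (θ : Matrix (Fin 2) (Fin 2) ℤ)) ih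
          simp only [add_mul, sub_mul, mul_assoc, hT, mul_one, one_mul] at ih2
          rw [sub_mul, one_mul]
          have := eq_sub_of_add_eq ih2
          rw [this]
          abel
      refine ⟨fun g => - (y ⬝ᵥ D.vec g), ?_⟩
      funext gk
      obtain ⟨g, k⟩ := gk
      change - (y ⬝ᵥ D.vec k) - - (y ⬝ᵥ D.vec (g * k)) + - (y ⬝ᵥ D.vec g) =
        x ⬝ᵥ (S (D.ht g) *ᵥ D.vec k)
      rw [hx, ← dotProduct_mulVec, mulVec_mulVec, hSM, D.vec_mul, dotProduct_add, sub_mulVec,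
        dotProduct_sub, one_mulVec]
      ring
  have hker : Ψ.ker = P.ker := by
    ext x
    rw [AddMonoidHom.mem_ker, AddMonoidHom.mem_ker, hΨk, hPk]
  exact ⟨(QuotientAddGroup.quotientKerEquivOfSurjective Ψ hΨs).symm.trans
    ((QuotientAddGroup.quotientAddEquivOfEq hker).trans
      (QuotientAddGroup.quotientKerEquivOfSurjective P hPs))⟩
end

section
/- If the integer matrix θ − I has rank 2 and det θ = 1, then there exist positive integers c₁, c₂ with c₁ ∣ c₂ and c₁·c₂ = |det(θ − I)| such that H²(G, ℤ) ≅ ℤ/c₁ ⊕ ℤ/c₂ ⊕ ℤ. -/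
lemma tb_gcd_lcm (a b : ℕ) (ha : 0 < a) (_hb : 0 < b) :
    ∃ π : (ℤ × ℤ) →+ ZMod (a.gcd b) × ZMod (a.lcm b), Function.Surjective π ∧
      ∀ x, π x = 0 ↔ (a : ℤ) ∣ x.1 ∧ (b : ℤ) ∣ x.2 := by
  have hg : 0 < a.gcd b := Nat.gcd_pos_of_pos_left _ ha
  obtain ⟨a', ha'⟩ := Nat.gcd_dvd_left a b
  obtain ⟨b', hb'⟩ := Nat.gcd_dvd_right a b
  have hl : a.lcm b = a.gcd b * a' * b' := by
    have := Nat.gcd_mul_lcm a b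
    apply Nat.eq_of_mul_eq_mul_left hg
    rw [this]; nth_rewrite 1 [ha']; nth_rewrite 2 [hb']; ring
  have hbez := Nat.gcd_eq_gcd_ab a b
  set u := a.gcdA b
  set v := a.gcdB b
  set g := a.gcd b
  have haz : (a : ℤ) = g * a' := by exact_mod_cast ha'
  have hbz : (b : ℤ) = g * b' := by exact_mod_cast hb'
  have hlz : ((a.lcm b : ℕ) : ℤ) = g * a' * b' := by exact_mod_cast hl
  have hgz : (g : ℤ) ≠ 0 := by exact_mod_cast hg.ne'
  have h1 : a' * u + b' * v = 1 := by
    apply mul_left_cancel₀ hgz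
    rw [haz, hbz] at hbez
    linarith
  refine ⟨((Int.castAddHom _).comp (u • AddMonoidHom.fst ℤ ℤ + v • AddMonoidHom.snd ℤ ℤ)).prod
    ((Int.castAddHom _).comp ((-(b':ℤ)) • AddMonoidHom.fst ℤ ℤ + (a':ℤ) • AddMonoidHom.snd ℤ ℤ)), ?_, ?_⟩
  · rintro ⟨p, q⟩
    obtain ⟨p, rfl⟩ := ZMod.intCast_surjective p
    obtain ⟨q, rfl⟩ := ZMod.intCast_surjective q
    refine ⟨(a' * p - v * q, b' * p + u * q), ?_⟩
    ext
    · simp only [AddMonoidHom.prod_apply, AddMonoidHom.comp_apply, AddMonoidHom.add_apply, AddMonoidHom.smul_apply, AddMonoidHom.coe_fst, AddMonoidHom.coe_snd, Int.coe_castAddHom, smul_eq_mul]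
      congr 1
      linear_combination p * h1
    · simp only [AddMonoidHom.prod_apply, AddMonoidHom.comp_apply, AddMonoidHom.add_apply, AddMonoidHom.smul_apply, AddMonoidHom.coe_fst, AddMonoidHom.coe_snd, Int.coe_castAddHom, smul_eq_mul]
      congr 1
      linear_combination q * h1
  · rintro ⟨x, y⟩
    simp only [AddMonoidHom.prod_apply, AddMonoidHom.comp_apply, AddMonoidHom.add_apply, AddMonoidHom.smul_apply, AddMonoidHom.coe_fst, AddMonoidHom.coe_snd, Int.coe_castAddHom, smul_eq_mul, Prod.mk_eq_zero, ZMod.intCast_zmod_eq_zero_iff_dvd]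
    rw [hlz, haz, hbz]
    constructor
    · rintro ⟨⟨p, hp⟩, ⟨q, hq⟩⟩
      exact ⟨⟨p - v * b' * q, by linear_combination a' * hp - v * hq - x * h1⟩,
        ⟨p + u * a' * q, by linear_combination b' * hp + u * hq - y * h1⟩⟩
    · rintro ⟨⟨p, rfl⟩, ⟨q, rfl⟩⟩
      exact ⟨⟨u * a' * p + v * b' * q, by ring⟩, ⟨q - p, by ring⟩⟩

lemma tb_coker (M : Matrix (Fin 2) (Fin 2) ℤ) (h : M.det ≠ 0) :
    ∃ c₁ c₂ : ℕ, 0 < c₁ ∧ 0 < c₂ ∧ c₁ ∣ c₂ ∧ c₁ * c₂ = M.det.natAbs ∧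
      ∃ π : (Fin 2 → ℤ) →+ ZMod c₁ × ZMod c₂, Function.Surjective π ∧
        ∀ l, π l = 0 ↔ ∃ m, l = Matrix.vecMul m M := by
  classical
  have hinj : Function.Injective (Matrix.vecMulLinear M) := by
    rw [← LinearMap.ker_eq_bot, LinearMap.ker_eq_bot']
    intro m hm
    exact Matrix.eq_zero_of_vecMul_eq_zero h hm
  let N := LinearMap.range (Matrix.vecMulLinear M)
  let e : (Fin 2 → ℤ) ≃ₗ[ℤ] N := LinearEquiv.ofInjective _ hinj
  have hcard := Submodule.natAbs_det_equiv N e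
  have hdet : LinearMap.det (N.subtype ∘ₗ AddMonoidHom.toIntLinearMap (e : (Fin 2 → ℤ) →+ N)) = M.det := by
    have : (N.subtype ∘ₗ AddMonoidHom.toIntLinearMap (e : (Fin 2 → ℤ) →+ N)) = Matrix.toLin' M.transpose := by
      refine LinearMap.ext fun x => ?_
      rw [Matrix.toLin'_apply, Matrix.mulVec_transpose]
      rfl
    rw [this, LinearMap.det_toLin', Matrix.det_transpose]
  rw [hdet] at hcard
  have hfr : Module.finrank ℤ N = Module.finrank ℤ (Fin 2 → ℤ) := e.symm.finrank_eq
  let E := N.quotientEquivPiZMod (Pi.basisFun ℤ (Fin 2)) hfr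
  set c : Fin 2 → ℕ := fun i => (Submodule.smithNormalFormCoeffs (Pi.basisFun ℤ (Fin 2)) hfr i).natAbs with hc
  have hcc : c 0 * c 1 = M.det.natAbs := by
    rw [hcard]
    have := Nat.card_congr E.toEquiv
    rw [← Fin.prod_univ_two]
    refine Eq.trans ?_ (this.symm)
    rw [Nat.card_pi]
    simp [hc]
  have h0 : 0 < c 0 * c 1 := by rw [hcc]; exact Int.natAbs_pos.2 h
  have hc0 : 0 < c 0 := Nat.pos_of_mul_pos_right h0
  have hc1 : 0 < c 1 := Nat.pos_of_mul_pos_left h0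
  obtain ⟨π, hπ, hk⟩ := tb_gcd_lcm _ _ hc0 hc1
  -- factor π through the product of the cyclic groups
  let ρ : (ℤ × ℤ) →+ ZMod (c 0) × ZMod (c 1) := (Int.castAddHom _).prodMap (Int.castAddHom _)
  have hρ : Function.Surjective ρ := by
    rintro ⟨p, q⟩
    obtain ⟨p, rfl⟩ := ZMod.intCast_surjective p
    obtain ⟨q, rfl⟩ := ZMod.intCast_surjective q
    exact ⟨(p, q), rfl⟩
  have hker : ρ.ker = π.ker := by
    ext x
    rw [AddMonoidHom.mem_ker, AddMonoidHom.mem_ker, hk]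
    simp [ρ, Prod.ext_iff, ZMod.intCast_zmod_eq_zero_iff_dvd]
  let F : ZMod (c 0) × ZMod (c 1) ≃+ ZMod ((c 0).gcd (c 1)) × ZMod ((c 0).lcm (c 1)) :=
    (QuotientAddGroup.quotientKerEquivOfSurjective ρ hρ).symm.trans
      ((QuotientAddGroup.quotientAddEquivOfEq hker).trans
        (QuotientAddGroup.quotientKerEquivOfSurjective π hπ))
  let P : (∀ i, ZMod (c i)) ≃+ ZMod (c 0) × ZMod (c 1) :=
    { toFun := fun f => (f 0, f 1)
      invFun := fun f => Fin.cons f.1 (Fin.cons f.2 finZeroElim)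
      left_inv := by intro f; ext i; fin_cases i <;> rfl
      right_inv := by intro f; rfl
      map_add' := by intros; rfl }
  let T : ((Fin 2 → ℤ) ⧸ N) ≃+ _ := (E.trans P).trans F
  refine ⟨(c 0).gcd (c 1), (c 0).lcm (c 1), Nat.gcd_pos_of_pos_left _ hc0, Nat.lcm_pos hc0 hc1,
    (Nat.gcd_dvd_left _ _).trans (Nat.dvd_lcm_left _ _), by rw [Nat.gcd_mul_lcm, hcc],
    (T : ((Fin 2 → ℤ) ⧸ N) →+ _).comp N.mkQ.toAddMonoidHom, ?_, ?_⟩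
  · exact T.surjective.comp N.mkQ_surjective
  · intro l
    have : T (N.mkQ l) = 0 ↔ N.mkQ l = 0 := map_eq_zero_iff T T.injective
    refine this.trans ?_
    rw [Submodule.mkQ_apply, Submodule.Quotient.mk_eq_zero]
    constructor
    · rintro ⟨m, rfl⟩; exact ⟨m, rfl⟩
    · rintro ⟨m, rfl⟩; exact ⟨m, rfl⟩

lemma tb_det_ne (M : Matrix (Fin 2) (Fin 2) ℤ) (hr : M.rank = 2) : M.det ≠ 0 := by
  intro h
  obtain ⟨v, hv, hv0⟩ := Matrix.exists_mulVec_eq_zero_iff.2 h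
  have h1' := (M.mulVecLin).ker.finrank_quotient_add_finrank
  rw [(M.mulVecLin.quotKerEquivRange).finrank_eq] at h1'
  have h2 : Module.finrank ℤ (LinearMap.ker M.mulVecLin) = 0 := by
    have : Module.finrank ℤ (LinearMap.range M.mulVecLin) = 2 := hr
    simp at h1'
    omega
  have h3 : LinearMap.ker M.mulVecLin = ⊥ := by
    exact Submodule.finrank_eq_zero.1 h2
  have : v ∈ LinearMap.ker M.mulVecLin := hv0
  rw [h3] at this
  exact hv this

open Multiplicative in
/-- The action of `s ∈ ℤ` on `ℤ²`, additively. -/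
noncomputable def tbS (θ : GL (Fin 2) ℤ) (s : ℤ) (v : Fin 2 → ℤ) : Fin 2 → ℤ :=
  toAdd (torusAction θ (ofAdd s) (ofAdd v))

lemma tbS_add (θ : GL (Fin 2) ℤ) (s t : ℤ) (v : Fin 2 → ℤ) :
    tbS θ (s + t) v = tbS θ s (tbS θ t v) := by
  simp [tbS, ofAdd_add, map_mul]

lemma tbS_zero (θ : GL (Fin 2) ℤ) (v : Fin 2 → ℤ) : tbS θ 0 v = v := by
  simp [tbS]

lemma tbS_vadd (θ : GL (Fin 2) ℤ) (s : ℤ) (v w : Fin 2 → ℤ) :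
    tbS θ s (v + w) = tbS θ s v + tbS θ s w := by
  simp [tbS, ofAdd_add, map_mul]

lemma tbS_vzero (θ : GL (Fin 2) ℤ) (s : ℤ) : tbS θ s 0 = 0 := by
  have := tbS_vadd θ s 0 0
  simpa using this

lemma tbS_one (θ : GL (Fin 2) ℤ) (v : Fin 2 → ℤ) :
    tbS θ 1 v = (θ : Matrix (Fin 2) (Fin 2) ℤ).mulVec v := by
  simp [tbS, torusAction, torusAut, zpowersHom_apply]

noncomputable def tbV {θ : GL (Fin 2) ℤ} (g : TorusBundleGroup θ) : Fin 2 → ℤ :=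
  Multiplicative.toAdd (SemidirectProduct.left g)

noncomputable def tbT {θ : GL (Fin 2) ℤ} (g : TorusBundleGroup θ) : ℤ :=
  Multiplicative.toAdd (SemidirectProduct.right g)

noncomputable def tbMk (θ : GL (Fin 2) ℤ) (v : Fin 2 → ℤ) (s : ℤ) : TorusBundleGroup θ :=
  (⟨Multiplicative.ofAdd v, Multiplicative.ofAdd s⟩ : SemidirectProduct _ _ _)

@[simp] lemma tbV_mk (θ : GL (Fin 2) ℤ) (v : Fin 2 → ℤ) (s : ℤ) : tbV (tbMk θ v s) = v := rfl
@[simp] lemma tbT_mk (θ : GL (Fin 2) ℤ) (v : Fin 2 → ℤ) (s : ℤ) : tbT (tbMk θ v s) = s := rfl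
lemma tbMk_eta {θ : GL (Fin 2) ℤ} (g : TorusBundleGroup θ) : tbMk θ (tbV g) (tbT g) = g := rfl

lemma tbV_mul {θ : GL (Fin 2) ℤ} (g h : TorusBundleGroup θ) :
    tbV (g * h) = tbV g + tbS θ (tbT g) (tbV h) := rfl
lemma tbT_mul {θ : GL (Fin 2) ℤ} (g h : TorusBundleGroup θ) :
    tbT (g * h) = tbT g + tbT h := rfl

lemma tbMk_mul (θ : GL (Fin 2) ℤ) (v w : Fin 2 → ℤ) (s t : ℤ) :
    tbMk θ v s * tbMk θ w t = tbMk θ (v + tbS θ s w) (s + t) := rfl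

lemma tbMk_zero (θ : GL (Fin 2) ℤ) : tbMk θ 0 0 = 1 := rfl

lemma tb_int_ind {P : ℤ → Prop} (h0 : P 0) (h : ∀ n, P n ↔ P (n + 1)) (n : ℤ) : P n := by
  induction n using Int.induction_on with
  | zero => exact h0
  | succ n ih => exact (h _).1 ih
  | pred n ih => exact (h _).2 (by simpa using ih)

/-- `Σ_{0 ≤ i < s} p (θ^i w)`, extended to all integers `s`. -/
noncomputable def tbSum (θ : GL (Fin 2) ℤ) (p : (Fin 2 → ℤ) → ℤ) (s : ℤ) (w : Fin 2 → ℤ) : ℤ :=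
  ∑ i ∈ Finset.Ico 0 s, p (tbS θ i w) - ∑ i ∈ Finset.Ico s 0, p (tbS θ i w)

lemma tbSum_zero (θ : GL (Fin 2) ℤ) (p : (Fin 2 → ℤ) → ℤ) (w : Fin 2 → ℤ) :
    tbSum θ p 0 w = 0 := by simp [tbSum]

lemma tbSum_succ (θ : GL (Fin 2) ℤ) (p : (Fin 2 → ℤ) → ℤ) (s : ℤ) (w : Fin 2 → ℤ) :
    tbSum θ p (s + 1) w = tbSum θ p s w + p (tbS θ s w) := by
  unfold tbSum
  rcases le_or_gt 0 s with hs | hs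
  · have h1 : Finset.Ico 0 (s + 1) = insert s (Finset.Ico 0 s) := by ext; simp; omega
    have h2 : Finset.Ico s 0 = ∅ := by ext; simp; omega
    have h3 : Finset.Ico (s + 1) 0 = ∅ := by ext; simp; omega
    rw [h1, h2, h3, Finset.sum_insert (by simp)]
    simp; ring
  · have h1 : Finset.Ico s 0 = insert s (Finset.Ico (s + 1) 0) := by ext; simp; omega
    have h2 : Finset.Ico 0 s = ∅ := by ext; simp; omega
    have h3 : Finset.Ico 0 (s + 1) = ∅ := by ext; simp; omega
    rw [h1, h2, h3, Finset.sum_insert (by simp)]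
    simp

lemma tbSum_one (θ : GL (Fin 2) ℤ) (p : (Fin 2 → ℤ) → ℤ) (w : Fin 2 → ℤ) :
    tbSum θ p 1 w = p w := by
  have := tbSum_succ θ p 0 w
  simpa [tbSum_zero, tbS_zero] using this

lemma tbSum_padd (θ : GL (Fin 2) ℤ) (p p' : (Fin 2 → ℤ) → ℤ) (s : ℤ) (w : Fin 2 → ℤ) :
    tbSum θ (p + p') s w = tbSum θ p s w + tbSum θ p' s w := by
  simp [tbSum, Finset.sum_add_distrib]; ring

lemma tbSum_add (θ : GL (Fin 2) ℤ) (p : (Fin 2 → ℤ) → ℤ) (s t : ℤ) (w : Fin 2 → ℤ) :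
    tbSum θ p (s + t) w = tbSum θ p t w + tbSum θ p s (tbS θ t w) := by
  refine tb_int_ind (P := fun s => tbSum θ p (s + t) w = tbSum θ p t w + tbSum θ p s (tbS θ t w))
    ?_ ?_ s
  · simp [tbSum_zero]
  · intro n
    have : n + 1 + t = (n + t) + 1 := by ring
    rw [this, tbSum_succ, tbSum_succ, tbS_add]
    constructor <;> intro h <;> linarith

/-- The half-symplectic form. -/
def tbW (v w : Fin 2 → ℤ) : ℤ := v 0 * w 1

lemma tbW_add_left (u v w : Fin 2 → ℤ) : tbW (u + v) w = tbW u w + tbW v w := by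
  simp [tbW]; ring
lemma tbW_add_right (u v w : Fin 2 → ℤ) : tbW u (v + w) = tbW u v + tbW u w := by
  simp [tbW]; ring

lemma tbSum_vadd (θ : GL (Fin 2) ℤ) (p : (Fin 2 → ℤ) → ℤ) (z : ℤ)
    (hp : ∀ v w, p (v + w) = p v + p w + z * (tbW (tbS θ 1 v) (tbS θ 1 w) - tbW v w))
    (s : ℤ) (v w : Fin 2 → ℤ) :
    tbSum θ p s (v + w) = tbSum θ p s v + tbSum θ p s w +
      z * (tbW (tbS θ s v) (tbS θ s w) - tbW v w) := by
  refine tb_int_ind (P := fun s => tbSum θ p s (v + w) = tbSum θ p s v + tbSum θ p s w +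
      z * (tbW (tbS θ s v) (tbS θ s w) - tbW v w)) ?_ ?_ s
  · simp [tbSum_zero, tbS_zero]
  · intro n
    rw [tbSum_succ, tbSum_succ, tbSum_succ, tbS_vadd, hp, add_comm n 1, tbS_add, tbS_add]
    constructor <;> intro h <;> linarith

def tbTri (n : ℤ) : ℤ := n * (n - 1) / 2

lemma tbTri_two (n : ℤ) : 2 * tbTri n = n * (n - 1) := by
  apply Int.mul_ediv_cancel'
  exact (Int.even_mul_pred_self n).two_dvd

lemma tbTri_add (m n : ℤ) : tbTri (m + n) = tbTri m + tbTri n + m * n := by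
  have h1 := tbTri_two (m + n)
  have h2 := tbTri_two m
  have h3 := tbTri_two n
  have : 2 * tbTri (m + n) = 2 * (tbTri m + tbTri n + m * n) := by
    rw [h1]; linear_combination -h2 - h3
  linarith

/-- The quadratic function whose polarisation is `θ^* ω - ω`. -/
def tbQ (θ : GL (Fin 2) ℤ) (v : Fin 2 → ℤ) : ℤ :=
  (θ : Matrix (Fin 2) (Fin 2) ℤ) 0 0 * (θ : Matrix (Fin 2) (Fin 2) ℤ) 1 0 * tbTri (v 0) +
  (θ : Matrix (Fin 2) (Fin 2) ℤ) 0 1 * (θ : Matrix (Fin 2) (Fin 2) ℤ) 1 0 * (v 0 * v 1) +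
  (θ : Matrix (Fin 2) (Fin 2) ℤ) 0 1 * (θ : Matrix (Fin 2) (Fin 2) ℤ) 1 1 * tbTri (v 1)

lemma tbQ_add (θ : GL (Fin 2) ℤ) (hdet : (θ : Matrix (Fin 2) (Fin 2) ℤ).det = 1)
    (v w : Fin 2 → ℤ) :
    tbQ θ (v + w) = tbQ θ v + tbQ θ w + (tbW (tbS θ 1 v) (tbS θ 1 w) - tbW v w) := by
  rw [Matrix.det_fin_two] at hdet
  simp only [tbQ, tbW, tbS_one, Matrix.mulVec, dotProduct, Fin.sum_univ_two, Pi.add_apply,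
    tbTri_add]
  linear_combination (-v 0 * w 1) * hdet

/-- The function `z q + l`. -/
def tbP (θ : GL (Fin 2) ℤ) (x : ℤ × (Fin 2 → ℤ)) (v : Fin 2 → ℤ) : ℤ := x.1 * tbQ θ v + x.2 ⬝ᵥ v

lemma tbP_add (θ : GL (Fin 2) ℤ) (hdet : (θ : Matrix (Fin 2) (Fin 2) ℤ).det = 1)
    (x : ℤ × (Fin 2 → ℤ)) (v w : Fin 2 → ℤ) :
    tbP θ x (v + w) = tbP θ x v + tbP θ x w + x.1 * (tbW (tbS θ 1 v) (tbS θ 1 w) - tbW v w) := by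
  simp only [tbP, tbQ_add θ hdet, dotProduct_add]; ring

/-- The explicit cocycle. -/
noncomputable def tbPsi (θ : GL (Fin 2) ℤ) (x : ℤ × (Fin 2 → ℤ))
    (g : TorusBundleGroup θ × TorusBundleGroup θ) : ℤ :=
  x.1 * tbW (tbV g.1) (tbS θ (tbT g.1) (tbV g.2)) + tbSum θ (tbP θ x) (tbT g.1) (tbV g.2)

lemma tbPsi_cocycle (θ : GL (Fin 2) ℤ) (hdet : (θ : Matrix (Fin 2) (Fin 2) ℤ).det = 1)
    (x : ℤ × (Fin 2 → ℤ)) (g h j : TorusBundleGroup θ) :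
    tbPsi θ x (g * h, j) + tbPsi θ x (g, h) = tbPsi θ x (h, j) + tbPsi θ x (g, h * j) := by
  simp only [tbPsi, tbV_mul, tbT_mul, tbW_add_left, tbW_add_right, tbS_vadd, tbS_add, tbSum_add,
    tbSum_vadd θ _ _ (tbP_add θ hdet x)]
  ring

lemma tbPsi_add (θ : GL (Fin 2) ℤ) (x y : ℤ × (Fin 2 → ℤ)) :
    tbPsi θ (x + y) = tbPsi θ x + tbPsi θ y := by
  have h : tbP θ (x + y) = tbP θ x + tbP θ y := by
    ext v; simp [tbP, add_dotProduct]; ring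
  ext g
  simp only [tbPsi, h, tbSum_padd, Pi.add_apply, Prod.fst_add]
  ring

lemma tbPsi_cobound_iff (θ : GL (Fin 2) ℤ) (x : ℤ × (Fin 2 → ℤ)) :
    (∃ k : TorusBundleGroup θ → ℤ, ∀ g h, tbPsi θ x (g, h) = k h - k (g * h) + k g) ↔
      x.1 = 0 ∧ ∃ m, x.2 = Matrix.vecMul m ((θ : Matrix (Fin 2) (Fin 2) ℤ) - 1) := by
  obtain ⟨z, l⟩ := x
  constructor
  · rintro ⟨k, hk⟩
    have hN : ∀ v w, z * tbW v w = k (tbMk θ w 0) - k (tbMk θ (v + w) 0) + k (tbMk θ v 0) := by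
      intro v w
      have := hk (tbMk θ v 0) (tbMk θ w 0)
      simpa [tbPsi, tbMk_mul, tbS_zero, tbSum_zero] using this
    have hz : z = 0 := by
      have h1 := hN ![1, 0] ![0, 1]
      have h2 := hN ![0, 1] ![1, 0]
      rw [add_comm] at h2
      simp [tbW] at h1 h2
      linarith
    subst hz
    refine ⟨rfl, ?_⟩
    have hadd : ∀ v w, k (tbMk θ (v + w) 0) = k (tbMk θ v 0) + k (tbMk θ w 0) := by
      intro v w; have := hN v w; linarith
    let K : (Fin 2 → ℤ) →+ ℤ := ⟨⟨fun v => k (tbMk θ v 0), by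
      have := hadd 0 0; simp only [add_zero] at this; linarith⟩, hadd⟩
    have hl : ∀ w, l ⬝ᵥ w = K w - K (tbS θ 1 w) := by
      intro w
      have h1 := hk (tbMk θ 0 1) (tbMk θ w 0)
      have h2 := hk (tbMk θ (tbS θ 1 w) 0) (tbMk θ 0 1)
      simp [tbPsi, tbMk_mul, tbSum_one, tbSum_zero, tbS_vzero, tbP] at h1 h2
      rw [show l ⬝ᵥ w = l 0 * w 0 + l 1 * w 1 by simp [dotProduct, Fin.sum_univ_two]]
      change _ = k (tbMk θ w 0) - k (tbMk θ (tbS θ 1 w) 0)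
      linarith
    have hK : ∀ v, K v = (fun i => K (Pi.single i 1)) ⬝ᵥ v := by
      intro v
      have : v = v 0 • Pi.single 0 1 + v 1 • Pi.single 1 1 := by
        ext i; fin_cases i <;> simp
      conv_lhs => rw [this]
      rw [map_add, map_zsmul, map_zsmul]
      simp [dotProduct, Fin.sum_univ_two, mul_comm]
    refine ⟨-(fun i => K (Pi.single i 1)), ?_⟩
    ext i
    have := hl (Pi.single i 1)
    rw [dotProduct_single_one, hK, hK (tbS _ _ _), tbS_one, Matrix.dotProduct_mulVec,
      dotProduct_single_one, dotProduct_single_one] at this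
    simp only [this, Matrix.vecMul_sub, Matrix.neg_vecMul, Matrix.vecMul_one, Pi.sub_apply, Pi.neg_apply]
    ring
  · rintro ⟨hz, m, hm⟩
    simp only at hz hm
    subst hz hm
    refine ⟨fun g => - (m ⬝ᵥ tbV g), fun g h => ?_⟩
    have key : ∀ s w, tbSum θ (tbP θ (0, Matrix.vecMul m ((θ : Matrix (Fin 2) (Fin 2) ℤ) - 1))) s w
        = m ⬝ᵥ tbS θ s w - m ⬝ᵥ w := by
      intro s w
      refine tb_int_ind (P := fun s => tbSum θ (tbP θ (0, Matrix.vecMul m ((θ : Matrix (Fin 2) (Fin 2) ℤ) - 1))) s w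
        = m ⬝ᵥ tbS θ s w - m ⬝ᵥ w) ?_ ?_ s
      · simp [tbSum_zero, tbS_zero]
      · intro n
        rw [tbSum_succ, add_comm n 1, tbS_add, tbS_one]
        simp only [tbP, zero_mul, zero_add, ← Matrix.dotProduct_mulVec, Matrix.sub_mulVec,
          Matrix.one_mulVec, dotProduct_sub]
        constructor <;> intro h <;> linarith
    simp only [tbPsi, key, tbV_mul, dotProduct_add, zero_mul]
    ring

/-- The extension attached to a 2-cocycle. -/
structure TBExt {G : Type} [Group G]
    (f : {f : G × G → ℤ // ∀ g h j, f (g * h, j) + f (g, h) = f (h, j) + f (g, h * j)}) where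
  fst : G
  snd : ℤ

namespace TBExt
variable {G : Type} [Group G]
    {f : {f : G × G → ℤ // ∀ g h j, f (g * h, j) + f (g, h) = f (h, j) + f (g, h * j)}}

@[ext] lemma ext' {x y : TBExt f} (h1 : x.fst = y.fst) (h2 : x.snd = y.snd) : x = y := by
  cases x; cases y; simp_all

instance : Mul (TBExt f) := ⟨fun x y => ⟨x.fst * y.fst, x.snd + y.snd + f.1 (x.fst, y.fst)⟩⟩
instance : One (TBExt f) := ⟨⟨1, - f.1 (1, 1)⟩⟩
instance : Inv (TBExt f) := ⟨fun x => ⟨x.fst⁻¹, - x.snd - f.1 (x.fst⁻¹, x.fst) - f.1 (1, 1)⟩⟩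

lemma mul_fst (x y : TBExt f) : (x * y).fst = x.fst * y.fst := rfl
lemma mul_snd (x y : TBExt f) : (x * y).snd = x.snd + y.snd + f.1 (x.fst, y.fst) := rfl
lemma one_fst : (1 : TBExt f).fst = 1 := rfl
lemma one_snd : (1 : TBExt f).snd = - f.1 (1, 1) := rfl
lemma inv_fst (x : TBExt f) : x⁻¹.fst = x.fst⁻¹ := rfl
lemma inv_snd (x : TBExt f) : x⁻¹.snd = - x.snd - f.1 (x.fst⁻¹, x.fst) - f.1 (1, 1) := rfl

lemma f_one_left (g : G) : f.1 (1, g) = f.1 (1, 1) := by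
  have := f.2 1 1 g
  simp only [one_mul] at this
  linarith

lemma f_one_right (g : G) : f.1 (g, 1) = f.1 (1, 1) := by
  have := f.2 g 1 1
  simp only [mul_one] at this
  linarith

noncomputable instance : Group (TBExt f) := Group.ofLeftAxioms
  (by
    intro x y z
    ext
    · simp [mul_fst, mul_assoc]
    · simp only [mul_snd, mul_fst]
      have := f.2 x.fst y.fst z.fst
      linarith)
  (by
    intro x
    ext
    · simp [mul_fst, one_fst]
    · simp only [mul_snd, one_fst, one_snd, f_one_left]
      ring)
  (by
    intro x
    ext
    · simp [mul_fst, one_fst, inv_fst]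
    · simp only [mul_snd, one_snd, inv_fst, inv_snd]
      ring)

/-- The projection. -/
noncomputable def proj : TBExt f →* G := MonoidHom.mk' TBExt.fst (fun _ _ => rfl)

/-- The central inclusion. -/
noncomputable def inc (c : ℤ) : TBExt f := ⟨1, c - f.1 (1, 1)⟩

lemma mul_inc (x : TBExt f) (c : ℤ) : x * inc c = ⟨x.fst, x.snd + c⟩ := by
  ext
  · simp [mul_fst, inc]
  · simp only [mul_snd, inc, f_one_right]; ring

lemma inc_mul (x : TBExt f) (c : ℤ) : inc c * x = x * inc c := by
  rw [mul_inc]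
  ext
  · simp [mul_fst, inc]
  · simp only [mul_snd, inc, f_one_left]; ring

lemma inc_add (c d : ℤ) : (inc (c + d) : TBExt f) = inc c * inc d := by
  rw [mul_inc]; ext
  · rfl
  · simp only [inc]; ring

lemma inc_zero : (inc 0 : TBExt f) = 1 := by
  ext
  · rfl
  · simp [inc, one_snd]

lemma inc_zpow (c n : ℤ) : (inc c : TBExt f) ^ n = inc (n * c) := by
  refine tb_int_ind (P := fun n => (inc c : TBExt f) ^ n = inc (n * c)) ?_ ?_ n
  · simp [inc_zero]
  · intro n
    rw [zpow_add_one, add_mul, one_mul, inc_add]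
    exact (mul_left_inj _).symm

lemma inc_inj {x : TBExt f} {c d : ℤ} (h : x * inc c = x * inc d) : c = d := by
  rw [mul_inc, mul_inc] at h
  have := congrArg TBExt.snd h
  simpa using this

lemma exists_inc {x y : TBExt f} (h : x.fst = y.fst) : ∃ c, x = y * inc c := by
  refine ⟨x.snd - y.snd, ?_⟩
  rw [mul_inc]
  ext
  · exact h
  · simp

end TBExt

lemma tb_comm_zpow {E : Type*} [Group E] (A B C : E) (hC : ∀ x, Commute C x)
    (h : A * B = B * A * C) (m n : ℤ) : A ^ m * B ^ n = B ^ n * A ^ m * C ^ (m * n) := by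
  have h1 : A * B ^ n * A⁻¹ = B ^ n * C ^ n := by
    rw [← conj_zpow, ← (hC B).symm.mul_zpow]
    congr 1
    rw [h, mul_assoc, mul_assoc, (hC A⁻¹).eq, mul_inv_cancel_left]
  have h2 : (B ^ n)⁻¹ * A * ((B ^ n)⁻¹)⁻¹ = A * C ^ n := by
    have h1' := mul_inv_eq_iff_eq_mul.1 h1
    rw [inv_inv, mul_assoc, inv_mul_eq_iff_eq_mul, h1', mul_assoc, ((hC A).zpow_left n).eq]
  have h3 : (B ^ n)⁻¹ * A ^ m * ((B ^ n)⁻¹)⁻¹ = A ^ m * C ^ (m * n) := by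
    rw [← conj_zpow, h2, (((hC A).zpow_left n).symm).mul_zpow, ← zpow_mul, mul_comm n m]
  rw [inv_inv, mul_assoc, inv_mul_eq_iff_eq_mul] at h3
  rw [h3, mul_assoc]

open TBExt in
lemma tb_surj (θ : GL (Fin 2) ℤ) (hdet : (θ : Matrix (Fin 2) (Fin 2) ℤ).det = 1)
    (f : {f : TorusBundleGroup θ × TorusBundleGroup θ → ℤ //
      ∀ g h j, f (g * h, j) + f (g, h) = f (h, j) + f (g, h * j)}) :
    ∃ (x : ℤ × (Fin 2 → ℤ)) (k : TorusBundleGroup θ → ℤ),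
      ∀ g h, tbPsi θ x (g, h) - f.1 (g, h) = k h - k (g * h) + k g := by
  let A : TBExt f := ⟨tbMk θ ![1, 0] 0, 0⟩
  let B : TBExt f := ⟨tbMk θ ![0, 1] 0, 0⟩
  let T : TBExt f := ⟨tbMk θ 0 1, 0⟩
  obtain ⟨z, hz⟩ : ∃ z, A * B = B * A * inc z := by
    apply exists_inc
    simp only [mul_fst, A, B, tbMk_mul, tbS_zero, add_comm]
  have hcomm : ∀ (c : ℤ) (x : TBExt f), Commute (inc c) x := fun c x => inc_mul x c
  have hAB : ∀ m n : ℤ, A ^ m * B ^ n = B ^ n * A ^ m * inc (m * n * z) := by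
    intro m n
    rw [tb_comm_zpow A B (inc z) (hcomm z) hz, inc_zpow]
  let σ : (Fin 2 → ℤ) → TBExt f := fun v => B ^ v 1 * A ^ v 0
  have hσ : ∀ v w, σ v * σ w = σ (v + w) * inc (z * tbW v w) := by
    intro v w
    simp only [σ, Pi.add_apply, zpow_add]
    calc B ^ v 1 * A ^ v 0 * (B ^ w 1 * A ^ w 0)
        = B ^ v 1 * (A ^ v 0 * B ^ w 1) * A ^ w 0 := by group
      _ = B ^ v 1 * (B ^ w 1 * A ^ v 0 * inc (v 0 * w 1 * z)) * A ^ w 0 := by rw [hAB]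
      _ = B ^ v 1 * B ^ w 1 * A ^ v 0 * (inc (v 0 * w 1 * z) * A ^ w 0) := by group
      _ = B ^ v 1 * B ^ w 1 * A ^ v 0 * (A ^ w 0 * inc (v 0 * w 1 * z)) := by rw [inc_mul]
      _ = _ := by
        rw [tbW, mul_comm z]; group
  have hpA : ∀ n : ℤ, (A ^ n).fst = tbMk θ (n • ![1, 0]) 0 := by
    intro n
    refine tb_int_ind (P := fun n => (A ^ n).fst = tbMk θ (n • ![1, 0]) 0) ?_ ?_ n
    · simp [one_fst, tbMk_zero]
    · intro n
      have : tbMk θ ((n + 1) • ![1, 0]) 0 = tbMk θ (n • ![1, 0]) 0 * tbMk θ ![1, 0] 0 := by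
        rw [tbMk_mul, tbS_zero, add_smul, one_smul, add_zero]
      rw [zpow_add_one, mul_fst, this]
      exact (mul_left_inj _).symm
  have hpB : ∀ n : ℤ, (B ^ n).fst = tbMk θ (n • ![0, 1]) 0 := by
    intro n
    refine tb_int_ind (P := fun n => (B ^ n).fst = tbMk θ (n • ![0, 1]) 0) ?_ ?_ n
    · simp [one_fst, tbMk_zero]
    · intro n
      have : tbMk θ ((n + 1) • ![0, 1]) 0 = tbMk θ (n • ![0, 1]) 0 * tbMk θ ![0, 1] 0 := by
        rw [tbMk_mul, tbS_zero, add_smul, one_smul, add_zero]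
      rw [zpow_add_one, mul_fst, this]
      exact (mul_left_inj _).symm
  have hpT : ∀ n : ℤ, (T ^ n).fst = tbMk θ 0 n := by
    intro n
    refine tb_int_ind (P := fun n => (T ^ n).fst = tbMk θ 0 n) ?_ ?_ n
    · simp [one_fst, tbMk_zero]
    · intro n
      have : tbMk θ 0 (n + 1) = tbMk θ 0 n * tbMk θ 0 1 := by
        rw [tbMk_mul, tbS_vzero, add_zero]
      rw [zpow_add_one, mul_fst, this]
      exact (mul_left_inj _).symm
  have hpσ : ∀ v, (σ v).fst = tbMk θ v 0 := by
    intro v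
    simp only [σ, mul_fst, hpA, hpB, tbMk_mul, tbS_zero]
    congr 1
    ext i; fin_cases i <;> simp
  have hT : ∀ v, ∃ c, T * σ v = σ (tbS θ 1 v) * T * inc c := by
    intro v
    apply exists_inc
    simp [mul_fst, hpσ, T, tbMk_mul, tbS_vzero]
  choose p hp using hT
  have hpadd : ∀ v w, p (v + w) = p v + p w + z * (tbW (tbS θ 1 v) (tbS θ 1 w) - tbW v w) := by
    intro v w
    have e1 : T * (σ v * σ w) =
        σ (tbS θ 1 (v + w)) * T * inc (p (v + w) + z * tbW v w) := by
      rw [hσ, ← mul_assoc, hp, mul_assoc, ← inc_add]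
    have e2 : T * (σ v * σ w) = σ (tbS θ 1 (v + w)) * T *
        inc (z * tbW (tbS θ 1 v) (tbS θ 1 w) + p w + p v) := by
      rw [← mul_assoc, hp, mul_assoc, inc_mul, mul_assoc, ← mul_assoc T, hp]
      rw [inc_add, inc_add, tbS_vadd]
      simp only [← mul_assoc]
      rw [hσ]
      rw [mul_assoc (σ _) (inc _) T, inc_mul]
      simp only [← mul_assoc]
    have := inc_inj (e1.symm.trans e2)
    linarith
  have hTn : ∀ n v, T ^ n * σ v = σ (tbS θ n v) * T ^ n * inc (tbSum θ p n v) := by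
    intro n v
    refine tb_int_ind (P := fun n => T ^ n * σ v = σ (tbS θ n v) * T ^ n * inc (tbSum θ p n v))
      ?_ ?_ n
    · simp [tbS_zero, tbSum_zero, inc_zero]
    · intro n
      have e : σ (tbS θ (n + 1) v) * T ^ (n + 1) * inc (tbSum θ p (n + 1) v) =
          T * (σ (tbS θ n v) * T ^ n * inc (tbSum θ p n v)) := by
        rw [← mul_assoc T, ← mul_assoc T, hp, tbSum_succ, add_comm (tbSum θ p n v), inc_add,
          add_comm n 1, tbS_add, zpow_one_add]
        rw [mul_assoc (_ * T) (inc _) (T ^ n), inc_mul (T ^ n)]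
        simp only [← mul_assoc]
      rw [e, add_comm n 1, zpow_one_add, mul_assoc T]
      exact (mul_right_inj _).symm
  let S : TorusBundleGroup θ → TBExt f := fun g => σ (tbV g) * T ^ tbT g
  have hS1 : ∀ g, (S g).fst = g := by
    intro g
    simp only [S, mul_fst, hpσ, hpT, tbMk_mul, tbS_vzero, add_zero, zero_add]
    exact tbMk_eta g
  -- the additive part
  let L : (Fin 2 → ℤ) →+ ℤ := AddMonoidHom.mk' (fun v => p v - z * tbQ θ v) (by
    intro v w
    rw [hpadd, tbQ_add θ hdet]; ring)
  have hL : ∀ v, L v = (fun i => L (Pi.single i 1)) ⬝ᵥ v := by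
    intro v
    have : v = v 0 • Pi.single 0 1 + v 1 • Pi.single 1 1 := by
      ext i; fin_cases i <;> simp
    conv_lhs => rw [this]
    rw [map_add, map_zsmul, map_zsmul]
    simp [dotProduct, Fin.sum_univ_two, mul_comm]
  let x : ℤ × (Fin 2 → ℤ) := (z, fun i => L (Pi.single i 1))
  have hx : tbP θ x = p := by
    ext v
    simp only [tbP, x]
    rw [← hL]
    change z * tbQ θ v + (p v - z * tbQ θ v) = p v
    ring
  refine ⟨x, fun g => (S g).snd, fun g h => ?_⟩
  have hS : S g * S h = S (g * h) * inc (tbPsi θ x (g, h)) := by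
    simp only [tbPsi, hx, S, tbV_mul, tbT_mul]
    calc σ (tbV g) * T ^ tbT g * (σ (tbV h) * T ^ tbT h)
        = σ (tbV g) * (T ^ tbT g * σ (tbV h)) * T ^ tbT h := by simp only [mul_assoc]
      _ = σ (tbV g) * σ (tbS θ (tbT g) (tbV h)) * T ^ tbT g *
            (inc (tbSum θ p (tbT g) (tbV h)) * T ^ tbT h) := by
          rw [hTn]; simp only [mul_assoc]
      _ = σ (tbV g + tbS θ (tbT g) (tbV h)) *
            (inc (z * tbW (tbV g) (tbS θ (tbT g) (tbV h))) * (T ^ tbT g * T ^ tbT h)) *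
            inc (tbSum θ p (tbT g) (tbV h)) := by
          rw [hσ, inc_mul]; simp only [mul_assoc]
      _ = _ := by
          rw [inc_mul, ← zpow_add, inc_add]; simp only [mul_assoc]; rfl
  have := congrArg TBExt.snd hS
  rw [mul_inc, mul_snd, hS1, hS1] at this
  simp only at this ⊢
  linarith

lemma tb_mem_cobound {G : Type} [Group G] (f : G × G → ℤ) :
    f ∈ groupCohomology.coboundaries₂ (Rep.trivial ℤ G ℤ) ↔
      ∃ k : G → ℤ, ∀ g h, f (g, h) = k h - k (g * h) + k g := by
  constructor
  · rintro ⟨k, hk⟩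
    exact ⟨k, fun g h => (congrFun hk (g, h)).symm⟩
  · rintro ⟨k, hk⟩
    exact ⟨k, funext fun g => (hk g.1 g.2).symm⟩

lemma tb_mem_cocycle {G : Type} [Group G] (f : G × G → ℤ) :
    f ∈ groupCohomology.cocycles₂ (Rep.trivial ℤ G ℤ) ↔
      ∀ g h j, f (g * h, j) + f (g, h) = f (h, j) + f (g, h * j) :=
  groupCohomology.mem_cocycles₂_iff (A := Rep.trivial ℤ G ℤ) f

noncomputable def tbHom (θ : GL (Fin 2) ℤ) (hdet : (θ : Matrix (Fin 2) (Fin 2) ℤ).det = 1) :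
    (ℤ × (Fin 2 → ℤ)) →+ groupCohomology (Rep.trivial ℤ (TorusBundleGroup θ) ℤ) 2 :=
  (groupCohomology.H2π (Rep.trivial ℤ (TorusBundleGroup θ) ℤ)).hom.toAddMonoidHom.comp
    (AddMonoidHom.mk' (fun x => (⟨tbPsi θ x, (tb_mem_cocycle _).2 (tbPsi_cocycle θ hdet x)⟩ :
      groupCohomology.cocycles₂ (Rep.trivial ℤ (TorusBundleGroup θ) ℤ)))
      (fun x y => Subtype.ext (tbPsi_add θ x y)))

lemma tbHom_eq_zero (θ : GL (Fin 2) ℤ) (hdet : (θ : Matrix (Fin 2) (Fin 2) ℤ).det = 1)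
    (x : ℤ × (Fin 2 → ℤ)) : tbHom θ hdet x = 0 ↔
      x.1 = 0 ∧ ∃ m, x.2 = Matrix.vecMul m ((θ : Matrix (Fin 2) (Fin 2) ℤ) - 1) := by
  rw [← tbPsi_cobound_iff, ← tb_mem_cobound]
  exact groupCohomology.H2π_eq_zero_iff _

lemma tbHom_surj (θ : GL (Fin 2) ℤ) (hdet : (θ : Matrix (Fin 2) (Fin 2) ℤ).det = 1) :
    Function.Surjective (tbHom θ hdet) := by
  intro y
  induction y using groupCohomology.H2_induction_on with
  | h f =>
    obtain ⟨x, k, hk⟩ := tb_surj θ hdet ⟨f.1, (tb_mem_cocycle f.1).1 f.2⟩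
    refine ⟨x, (groupCohomology.H2π_eq_iff _ _).2 ?_⟩
    exact (tb_mem_cobound _).2 ⟨k, hk⟩

theorem torusBundle_H2_rank2_detOne (θ : GL (Fin 2) ℤ)
    (hr : ((θ : Matrix (Fin 2) (Fin 2) ℤ) - 1).rank = 2)
    (hdet : (θ : Matrix (Fin 2) (Fin 2) ℤ).det = 1) :
    ∃ c₁ c₂ : ℕ, 0 < c₁ ∧ 0 < c₂ ∧ c₁ ∣ c₂ ∧
      c₁ * c₂ = ((θ : Matrix (Fin 2) (Fin 2) ℤ) - 1).det.natAbs ∧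
      Nonempty ((groupCohomology (Rep.trivial ℤ (TorusBundleGroup θ) ℤ) 2) ≃+ (ZMod c₁ × ZMod c₂ × ℤ)) := by
  obtain ⟨c₁, c₂, h1, h2, h3, h4, π, hπ, hk⟩ := tb_coker _ (tb_det_ne _ hr)
  refine ⟨c₁, c₂, h1, h2, h3, h4, ?_⟩
  let R : (ℤ × (Fin 2 → ℤ)) →+ (ZMod c₁ × ZMod c₂) × ℤ :=
    (π.comp (AddMonoidHom.snd ℤ (Fin 2 → ℤ))).prod (AddMonoidHom.fst ℤ (Fin 2 → ℤ))
  have hR : Function.Surjective R := by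
    rintro ⟨a, z⟩
    obtain ⟨l, rfl⟩ := hπ a
    exact ⟨(z, l), rfl⟩
  have hker : (tbHom θ hdet).ker = R.ker := by
    ext x
    rw [AddMonoidHom.mem_ker, AddMonoidHom.mem_ker, tbHom_eq_zero, ← hk]
    simp only [R, AddMonoidHom.prod_apply, Prod.mk_eq_zero]
    exact and_comm
  exact ⟨((QuotientAddGroup.quotientKerEquivOfSurjective _ (tbHom_surj θ hdet)).symm.trans
    ((QuotientAddGroup.quotientAddEquivOfEq hker).trans
      (QuotientAddGroup.quotientKerEquivOfSurjective R hR))).trans AddEquiv.prodAssoc⟩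
end
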